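/- arXiv:1607.05936 — 4 statements merged into one kernel-verified Lean document; each statement's English description precedes it below -/
import Mathlib

section
/- Let X be a real Hilbert space and let G : X → X* (X* the continuous dual of X) be continuously Fréchet differentiable with globally Lipschitz derivative: there is M > 0 such that ‖δG(u) − δG(v)‖_{L(X,X*)} ≤ M‖u − v‖ for all u, v ∈ X. Suppose ū ∈ X and η, γ > 0 satisfy ‖G(ū)‖_{X*} ≤ η, ⟨δG(ū)v, v⟩ ≥ γ‖v‖² for all v ∈ X, and 2Mη/γ² < 1. Then there exists u ∈ X such that G(u) = 0, ‖u − ū‖ ≤ 2η/γ, and ⟨δG(u)v, v⟩ ≥ (1 − 2Mη/γ²)γ‖v‖² for all v ∈ X; moreover u is locally unique: u is the only zero of G in the open ball of radius 2(1 − 2Mη/γ²)γ/M centred at u. -/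
open Set Metric

theorem norm_image_sub_sub_le_of_lipschitz_fderiv
    {E F : Type*} [NormedAddCommGroup E] [NormedSpace ℝ E] [NormedAddCommGroup F] [NormedSpace ℝ F]
    {f : E → F} {f' : E → E →L[ℝ] F} {M : ℝ} (hf : ∀ u, HasFDerivAt f (f' u) u)
    (hLip : ∀ u v, ‖f' u - f' v‖ ≤ M * ‖u - v‖) (u w : E) :
    ‖f w - f u - f' u (w - u)‖ ≤ M / 2 * ‖w - u‖ ^ 2 := by
  set d := w - u with hd
  have hline : ∀ t : ℝ, HasDerivAt (fun t : ℝ => u + t • d) d t := fun t => by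
    simpa using ((hasDerivAt_id t).smul_const d).const_add u
  have hg : ∀ t : ℝ, HasDerivAt (fun t : ℝ => f (u + t • d) - f u - t • f' u d)
      (f' (u + t • d) d - f' u d) t := fun t => by
    have h := ((hf (u + t • d)).comp_hasDerivAt t (hline t)).sub_const (f u)
    simpa using! h.sub ((hasDerivAt_id t).smul_const (f' u d))
  have hB : ∀ t : ℝ, HasDerivAt (fun t : ℝ => M / 2 * ‖d‖ ^ 2 * t ^ 2) (M * ‖d‖ ^ 2 * t) t :=
    fun t => by
      have h := (hasDerivAt_pow 2 t).const_mul (M / 2 * ‖d‖ ^ 2)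
      convert! h using 1
      push_cast
      ring
  have key := image_norm_le_of_norm_deriv_right_le_deriv_boundary (a := 0) (b := 1)
    (fun t _ => (hg t).continuousAt.continuousWithinAt) (fun t _ => (hg t).hasDerivWithinAt)
    (by simp) hB (fun t ht => by
      calc ‖f' (u + t • d) d - f' u d‖ = ‖(f' (u + t • d) - f' u) d‖ := by simp
        _ ≤ ‖f' (u + t • d) - f' u‖ * ‖d‖ := ContinuousLinearMap.le_opNorm _ _
        _ ≤ M * ‖u + t • d - u‖ * ‖d‖ := by gcongr; exact hLip _ _
        _ = M * ‖d‖ ^ 2 * t := by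
          rw [add_sub_cancel_left, norm_smul, Real.norm_of_nonneg ht.1]; ring)
    (right_mem_Icc.mpr zero_le_one)
  simpa [hd] using key

section Coercive

variable {X : Type*} [NormedAddCommGroup X]

theorem mul_norm_le_norm_of_coercive [NormedSpace ℝ X] {B : X →L[ℝ] X →L[ℝ] ℝ} {γ : ℝ}
    (hB : ∀ v, γ * ‖v‖ ^ 2 ≤ B v v) (v : X) : γ * ‖v‖ ≤ ‖B v‖ := by
  rcases (norm_nonneg v).eq_or_lt with hv | hv
  · simp [← hv]
  · refine le_of_mul_le_mul_right ?_ hv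
    calc γ * ‖v‖ * ‖v‖ = γ * ‖v‖ ^ 2 := by ring
      _ ≤ B v v := hB v
      _ ≤ ‖B v v‖ := le_abs_self _
      _ ≤ ‖B v‖ * ‖v‖ := (B v).le_opNorm v

theorem IsCoercive.surjective [InnerProductSpace ℝ X] [CompleteSpace X]
    {B : X →L[ℝ] X →L[ℝ] ℝ} (hB : IsCoercive B) : Function.Surjective B := fun ℓ => by
  refine ⟨hB.continuousLinearEquivOfBilin.symm ((InnerProductSpace.toDual ℝ X).symm ℓ), ?_⟩
  ext w
  rw [← hB.continuousLinearEquivOfBilin_apply]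
  simp

theorem sub_mul_norm_sq_le_of_norm_sub_le [NormedSpace ℝ X] {A B : X →L[ℝ] X →L[ℝ] ℝ} {γ ε : ℝ}
    (hB : ∀ v, γ * ‖v‖ ^ 2 ≤ B v v) (hAB : ‖A - B‖ ≤ ε) (v : X) :
    (γ - ε) * ‖v‖ ^ 2 ≤ A v v := by
  have h : |(A - B) v v| ≤ ε * ‖v‖ ^ 2 := by
    calc ‖(A - B) v v‖ ≤ ‖A - B‖ * ‖v‖ * ‖v‖ := (A - B).le_opNorm₂ v v
      _ ≤ ε * ‖v‖ * ‖v‖ := by gcongr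
      _ = ε * ‖v‖ ^ 2 := by ring
  have h' : (A - B) v v = A v v - B v v := by simp
  rw [h'] at h
  linarith [hB v, neg_abs_le (A v v - B v v)]

end Coercive

/-- Existence of a zero by the simplified Newton iteration, whose linear solves all use the
derivative at the initial point. -/
theorem exists_zero_of_coercive_fderiv
    {X : Type*} [NormedAddCommGroup X] [InnerProductSpace ℝ X] [CompleteSpace X]
    {G : X → X →L[ℝ] ℝ} {dG : X → X →L[ℝ] X →L[ℝ] ℝ} (hdiff : ∀ u, HasFDerivAt G (dG u) u)
    {M η γ : ℝ} (hM : 0 < M) (hη : 0 < η) (hγ : 0 < γ)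
    (hLip : ∀ u v, ‖dG u - dG v‖ ≤ M * ‖u - v‖) {x : X} (hx : ‖G x‖ ≤ η)
    (hstab : ∀ v, γ * ‖v‖ ^ 2 ≤ dG x v v) (hsmall : 2 * M * η / γ ^ 2 < 1) :
    ∃ u, G u = 0 ∧ ‖u - x‖ ≤ 2 * η / γ := by
  have hcoer : IsCoercive (dG x) := ⟨γ, hγ, fun v => by linarith [hstab v, sq ‖v‖]⟩
  choose S hS using hcoer.surjective
  have hbelow := mul_norm_le_norm_of_coercive hstab
  set r := 2 * η / γ with hr
  set k := 2 * M * η / γ ^ 2 with hk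
  have hr0 : 0 ≤ r := by positivity
  have hk0 : 0 ≤ k := by positivity
  have hMr : M * r = k * γ := by rw [hr, hk]; field_simp
  have hγr : γ * r = 2 * η := by rw [hr]; field_simp
  set Φ : X → X := fun u => u - S (G u) with hΦ
  have hxs : x ∈ closedBall x r := mem_closedBall_self hr0
  have hmaps : MapsTo Φ (closedBall x r) (closedBall x r) := fun u hu => by
    rw [mem_closedBall, dist_eq_norm] at hu ⊢
    refine le_of_mul_le_mul_left ((hbelow _).trans ?_) hγ
    have htaylor := norm_image_sub_sub_le_of_lipschitz_fderiv hdiff hLip x u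
    have heq : dG x (Φ u - x) = -(G u - G x - dG x (u - x)) - G x := by
      simp only [hΦ, map_sub, hS]; abel
    calc ‖dG x (Φ u - x)‖ ≤ ‖G u - G x - dG x (u - x)‖ + ‖G x‖ := by
          rw [heq]; exact (norm_sub_le _ _).trans_eq (by rw [norm_neg])
      _ ≤ M / 2 * r ^ 2 + η := by
          gcongr
          exact htaylor.trans (by gcongr)
      _ = k * η + η := by
          linear_combination r / 2 * hMr + k / 2 * hγr
      _ ≤ γ * r := by rw [hγr]; nlinarith
  have hcontr : ContractingWith ⟨k, hk0⟩ (hmaps.restrict Φ _ _) := by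
    refine ⟨hsmall, LipschitzWith.of_dist_le_mul fun u w => ?_⟩
    change dist (Φ u) (Φ w) ≤ k * dist (u : X) w
    rw [dist_eq_norm, dist_eq_norm]
    refine le_of_mul_le_mul_left ((hbelow _).trans ?_) hγ
    have heq : dG x (Φ u - Φ w) = -(G u - G w - dG x (u - w)) := by
      simp only [hΦ, map_sub, hS]; abel
    rw [heq, norm_neg]
    calc ‖G u - G w - dG x (u - w)‖ ≤ M * r * ‖(u : X) - w‖ :=
          (convex_closedBall x r).norm_image_sub_le_of_norm_hasFDerivWithin_le'
            (fun y _ => (hdiff y).hasFDerivWithinAt)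
            (fun y hy => (hLip y x).trans (by
              rw [mem_closedBall, dist_eq_norm] at hy; gcongr)) w.2 u.2
      _ = γ * (k * ‖(u : X) - w‖) := by rw [hMr]; ring
  obtain ⟨u, hus, hfix, -⟩ := hcontr.exists_fixedPoint' isClosed_closedBall.isComplete hmaps hxs
    (edist_ne_top _ _)
  refine ⟨u, ?_, by simpa [dist_eq_norm] using hus⟩
  have hSu : S (G u) = 0 := sub_eq_self.mp hfix
  rw [← hS (G u), hSu, map_zero]

/-- A zero with coercive derivative is locally unique. -/
theorem eq_of_zero_of_coercive_fderiv
    {X : Type*} [NormedAddCommGroup X] [NormedSpace ℝ X]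
    {G : X → X →L[ℝ] ℝ} {dG : X → X →L[ℝ] X →L[ℝ] ℝ} (hdiff : ∀ u, HasFDerivAt G (dG u) u)
    {M c : ℝ} (hM : 0 < M) (hLip : ∀ u v, ‖dG u - dG v‖ ≤ M * ‖u - v‖) {u w : X}
    (hstab : ∀ v, c * ‖v‖ ^ 2 ≤ dG u v v) (hu : G u = 0) (hw : G w = 0)
    (hwu : ‖w - u‖ < 2 * c / M) : w = u := by
  have h := norm_image_sub_sub_le_of_lipschitz_fderiv hdiff hLip u w
  rw [hu, hw, sub_zero, zero_sub, norm_neg] at h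
  have hle := (mul_norm_le_norm_of_coercive hstab (w - u)).trans h
  rw [lt_div_iff₀ hM] at hwu
  by_contra hne
  have hpos : 0 < ‖w - u‖ := norm_pos_iff.mpr (sub_ne_zero.mpr hne)
  nlinarith

/-- **Inverse function theorem / quantitative existence result** (Theorem 4.1 of the paper).
`X` is a real Hilbert space, `G : X → X*` is continuously Fréchet differentiable with
globally Lipschitz derivative `dG`.  If `G` is small at `ū` (consistency `η`), `dG ū` is
coercive (stability `γ`), and `2Mη/γ² < 1`, then `G` has a zero `u` near `ū`, which is
stable and locally unique. -/
theorem inverse_function_theorem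
    {X : Type*} [NormedAddCommGroup X] [InnerProductSpace ℝ X] [CompleteSpace X]
    (G : X → X →L[ℝ] ℝ) (dG : X → X →L[ℝ] X →L[ℝ] ℝ)
    (hdiff : ∀ u : X, HasFDerivAt G (dG u) u)
    (hcont : Continuous dG)
    (M η γ : ℝ) (hM : 0 < M) (hη : 0 < η) (hγ : 0 < γ)
    (hLip : ∀ u v : X, ‖dG u - dG v‖ ≤ M * ‖u - v‖)
    (ubar : X)
    (hconsist : ‖G ubar‖ ≤ η)
    (hstab : ∀ v : X, γ * ‖v‖ ^ 2 ≤ dG ubar v v)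
    (hsmall : 2 * M * η / γ ^ 2 < 1) :
    ∃ u : X, G u = 0 ∧ ‖u - ubar‖ ≤ 2 * η / γ ∧
      (∀ v : X, (1 - 2 * M * η / γ ^ 2) * γ * ‖v‖ ^ 2 ≤ dG u v v) ∧
      (∀ w : X, ‖w - u‖ < 2 * (1 - 2 * M * η / γ ^ 2) * γ / M → G w = 0 → w = u) := by
  obtain ⟨u, hu, hdist⟩ := exists_zero_of_coercive_fderiv hdiff hM hη hγ hLip hconsist hstab hsmall
  have hu_stab : ∀ v, (1 - 2 * M * η / γ ^ 2) * γ * ‖v‖ ^ 2 ≤ dG u v v := fun v => by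
    have h := sub_mul_norm_sq_le_of_norm_sub_le hstab
      ((hLip u ubar).trans (mul_le_mul_of_nonneg_left hdist hM.le)) v
    have hc : (1 - 2 * M * η / γ ^ 2) * γ = γ - M * (2 * η / γ) := by field_simp
    rwa [hc]
  refine ⟨u, hu, hdist, hu_stab, fun w hwu hw => ?_⟩
  exact eq_of_zero_of_coercive_fderiv hdiff hM hLip hu_stab hu hw (by rwa [← mul_assoc])
end

section
/- Let V : (ℝ^m)⁶ → ℝ be twice continuously differentiable with V(0) = 0 and with bounded second derivatives, i.e. M₂ := Σ_{i,j=1}^{6} sup_{g ∈ (ℝ^m)⁶} sup_{|h₁| = |h₂| = 1} ∂_{i,j}V(g)[h₁, h₂] < ∞. For u : Λ → ℝ^m whose difference field Du is finitely supported, define the atomistic energy E^a(u) := Σ_{ℓ ∈ Λ} V(Du(ℓ)) (a finite sum). Then there is a constant C > 0 (independent of V, u, v) such that for all u, v : Λ → ℝ^m with finitely supported Du, Dv: |E^a(u) − E^a(v)| ≤ C M₂ (‖Du‖_{ℓ²(Λ)} + ‖Dv‖_{ℓ²(Λ)}) ‖Du − Dv‖_{ℓ²(Λ)}, where ‖Du‖²_{ℓ²(Λ)}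 := Σ_{ℓ ∈ Λ} Σ_{j=1}^{6} |D_j u(ℓ)|². -/
open Real

noncomputable section

/-- The rotation of the plane `ℝ²` through the angle `π/3`, as a matrix. -/
def rotQ6 : Matrix (Fin 2) (Fin 2) ℝ :=
  !![Real.cos (π / 3), -Real.sin (π / 3);
     Real.sin (π / 3),  Real.cos (π / 3)]

/-- The six nearest-neighbour directions `a_{j+1} = Q₆ʲ a₁`, `a₁ = (1,0)` (0-based index). -/
def avec (j : Fin 6) : EuclideanSpace ℝ (Fin 2) :=
  (EuclideanSpace.equiv (Fin 2) ℝ).symm ((rotQ6 ^ (j : ℕ)).mulVec ![1, 0])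

/-- The triangular lattice `Λ = Aℤ²`, parametrised by `ℤ²`:
`latPt p = p₁ a₁ + p₂ a₂` where `a₁ = (1,0)`, `a₂ = (cos(π/3), sin(π/3))` are the columns of `A`. -/
def latPt (p : ℤ × ℤ) : EuclideanSpace ℝ (Fin 2) :=
  (p.1 : ℝ) • avec 0 + (p.2 : ℝ) • avec 1

/-- Finite-difference operator `D_j u(x) = u(x + a_j) - u(x)`. -/
def Dj {m : ℕ} (u : EuclideanSpace ℝ (Fin 2) → EuclideanSpace ℝ (Fin m))
    (j : Fin 6) (x : EuclideanSpace ℝ (Fin 2)) : EuclideanSpace ℝ (Fin m) :=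
  u (x + avec j) - u x

/-- The atomistic energy `Eᵃ(u) = Σ_{ℓ ∈ Λ} V(Du(ℓ))`. -/
def Ea {m : ℕ} (V : (Fin 6 → EuclideanSpace ℝ (Fin m)) → ℝ)
    (u : EuclideanSpace ℝ (Fin 2) → EuclideanSpace ℝ (Fin m)) : ℝ :=
  ∑ᶠ p : ℤ × ℤ, V (fun j => Dj u j (latPt p))

/-- A lattice function which is constant along all but finitely many horizontal and vertical edges
is constant off a finite set. -/
lemma exists_finite_ne_const {E : Type*} (f : ℤ × ℤ → E)
    (h₁ : {p | f (p + (1, 0)) ≠ f p}.Finite) (h₂ : {p | f (p + (0, 1)) ≠ f p}.Finite) :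
    ∃ c, {p | f p ≠ c}.Finite := by
  obtain ⟨⟨a₁, a₂⟩, ha⟩ := (h₁.union h₂).bddBelow
  obtain ⟨⟨b₁, b₂⟩, hb⟩ := (h₁.union h₂).bddAbove
  have key : ∀ p : ℤ × ℤ, (p.1 < a₁ ∨ b₁ < p.1 ∨ p.2 < a₂ ∨ b₂ < p.2) →
      f (p + (1, 0)) = f p ∧ f (p + (0, 1)) = f p := by
    rintro ⟨x, y⟩ h
    constructor <;> by_contra hne
    · have h3 := ha (Or.inl hne)
      have h4 := hb (Or.inl hne)
      simp only [Prod.mk_le_mk] at h3 h4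
      omega
    · have h3 := ha (Or.inr hne)
      have h4 := hb (Or.inr hne)
      simp only [Prod.mk_le_mk] at h3 h4
      omega
  have col : ∀ x, (x < a₁ ∨ b₁ < x) → ∀ y y', f (x, y) = f (x, y') := by
    intro x hx y y'
    have h : Function.Periodic (fun y => f (x, y)) 1 := fun y => by
      simpa using (key (x, y) (by tauto)).2
    simpa using h.int_mul (y - y') y'
  have row : ∀ y, (y < a₂ ∨ b₂ < y) → ∀ x x', f (x, y) = f (x', y) := by
    intro y hy x x'
    have h : Function.Periodic (fun x => f (x, y)) 1 := fun x => by
      simpa using (key (x, y) (by tauto)).1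
    simpa using h.int_mul (x - x') x'
  refine ⟨f (b₁ + 1, b₂ + 1), (Set.finite_Icc (a₁, a₂) (b₁, b₂)).subset ?_⟩
  rintro ⟨x, y⟩ hne
  by_contra hmem
  simp only [Set.mem_Icc, Prod.mk_le_mk] at hmem
  apply hne
  by_cases hx : x < a₁ ∨ b₁ < x
  · rw [col x hx y (b₂ + 1), row (b₂ + 1) (by omega) x (b₁ + 1)]
  · rw [row y (by omega) x (b₁ + 1), col (b₁ + 1) (by omega) y (b₂ + 1)]

lemma finsum_translate_sub_eq_zero {E : Type*} [AddCommGroup E] (f : ℤ × ℤ → E) (c : E)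
    (h : {p | f p ≠ c}.Finite) (e : ℤ × ℤ) : ∑ᶠ p, (f (p + e) - f p) = 0 := by
  have h' : (Function.support fun p => f p - c).Finite := by
    simpa [Function.support, sub_eq_zero] using h
  have h'' : (Function.support fun p => f (p + e) - c).Finite :=
    h'.preimage (Equiv.addRight e).injective.injOn
  calc ∑ᶠ p, (f (p + e) - f p) = ∑ᶠ p, ((f (p + e) - c) - (f p - c)) := by simp
    _ = ∑ᶠ p, (f (p + e) - c) - ∑ᶠ p, (f p - c) := finsum_sub_distrib h'' h'
    _ = 0 := sub_eq_zero.2 (finsum_comp_equiv (Equiv.addRight e) (f := fun p => f p - c))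

/-- Coordinates of the directions `avec j` with respect to the lattice basis. -/
def avecCoord : Fin 6 → ℤ × ℤ :=
  ![(1, 0), (0, 1), (-1, 1), (-1, 0), (0, -1), (1, -1)]

lemma rotQ6_sq : rotQ6 ^ 2 = rotQ6 - 1 := by
  have h3 : √3 * √3 = 3 := by simp
  rw [pow_two, rotQ6, Real.cos_pi_div_three, Real.sin_pi_div_three]
  ext i j
  fin_cases i <;> fin_cases j <;> simp [Matrix.mul_apply, Fin.sum_univ_two] <;> linarith

lemma avec_eq_latPt (j : Fin 6) : avec j = latPt (avecCoord j) := by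
  have h2 := rotQ6_sq
  have h3 : rotQ6 ^ 3 = -1 := by
    rw [pow_succ, h2, sub_mul, ← pow_two, h2]; simp
  have h4 : rotQ6 ^ 4 = -rotQ6 := by rw [pow_succ, h3]; simp
  have h5 : rotQ6 ^ 5 = 1 - rotQ6 := by rw [pow_succ, h4, neg_mul, ← pow_two, h2]; simp
  ext i
  fin_cases j <;> fin_cases i <;>
    simp [avec, latPt, avecCoord, h2, h3, h4, h5, sub_eq_add_neg, add_comm]

lemma latPt_add (p q : ℤ × ℤ) : latPt (p + q) = latPt p + latPt q := by
  simp only [latPt, Prod.fst_add, Prod.snd_add, Int.cast_add, add_smul]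
  abel

lemma Dj_latPt {m : ℕ} (u : EuclideanSpace ℝ (Fin 2) → EuclideanSpace ℝ (Fin m)) (j : Fin 6)
    (p : ℤ × ℤ) : Dj u j (latPt p) = u (latPt (p + avecCoord j)) - u (latPt p) := by
  rw [Dj, latPt_add, avec_eq_latPt]

lemma finsum_Dj_eq_zero {m : ℕ} (w : EuclideanSpace ℝ (Fin 2) → EuclideanSpace ℝ (Fin m))
    (hw : {p : ℤ × ℤ | (fun j => Dj w j (latPt p)) ≠ 0}.Finite) (j : Fin 6) :
    ∑ᶠ p : ℤ × ℤ, Dj w j (latPt p) = 0 := by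
  have h : ∀ i, {p : ℤ × ℤ | w (latPt (p + avecCoord i)) ≠ w (latPt p)}.Finite := fun i =>
    hw.subset fun p hp h0 => hp (by
      have := congrFun h0 i
      rwa [Dj_latPt, Pi.zero_apply, sub_eq_zero] at this)
  obtain ⟨c, hc⟩ := exists_finite_ne_const (fun p => w (latPt p)) (h 0) (h 1)
  simpa only [Dj_latPt] using finsum_translate_sub_eq_zero _ c hc (avecCoord j)

/-- A bilinear form on a finite product is bounded by the sum of the bounds on its blocks. -/
lemma norm_bilin_le_of_single_le {ι E : Type*} [Fintype ι] [DecidableEq ι] [Nonempty ι]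
    [NormedAddCommGroup E] [NormedSpace ℝ E] [Nontrivial E]
    (B : (ι → E) →L[ℝ] (ι → E) →L[ℝ] ℝ) (K : ι → ι → ℝ)
    (hB : ∀ i j (h₁ h₂ : E), ‖h₁‖ = 1 → ‖h₂‖ = 1 → B (Pi.single i h₁) (Pi.single j h₂) ≤ K i j) :
    0 ≤ ∑ i, ∑ j, K i j ∧ ‖B‖ ≤ ∑ i, ∑ j, K i j := by
  have habs : ∀ i j (h₁ h₂ : E), ‖h₁‖ = 1 → ‖h₂‖ = 1 →
      |B (Pi.single i h₁) (Pi.single j h₂)| ≤ K i j := fun i j h₁ h₂ n₁ n₂ =>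
    abs_le'.2 ⟨hB i j h₁ h₂ n₁ n₂, by
      simpa [Pi.single_neg] using hB i j (-h₁) h₂ (by simpa using n₁) n₂⟩
  obtain ⟨e, he⟩ := exists_norm_eq E zero_le_one
  have hK : ∀ i j, 0 ≤ K i j := fun i j => (abs_nonneg _).trans (habs i j e e he he)
  have hsum : 0 ≤ ∑ i, ∑ j, K i j :=
    Finset.sum_nonneg fun i _ => Finset.sum_nonneg fun j _ => hK i j
  have hblock : ∀ i j (x y : E), |B (Pi.single i x) (Pi.single j y)| ≤ K i j * (‖x‖ * ‖y‖) := by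
    intro i j x y
    rcases eq_or_ne x 0 with rfl | hx
    · simp
    rcases eq_or_ne y 0 with rfl | hy
    · simp
    have hx' := norm_pos_iff.2 hx
    have hy' := norm_pos_iff.2 hy
    have h := habs i j (‖x‖⁻¹ • x) (‖y‖⁻¹ • y) (by simp [norm_smul, hx]) (by simp [norm_smul, hy])
    rw [Pi.single_smul, Pi.single_smul, map_smul, map_smul, smul_apply,
      smul_smul, smul_eq_mul, abs_mul, abs_of_pos (by positivity), ← mul_inv_rev, mul_comm,
      ← div_eq_mul_inv, div_le_iff₀ (by positivity)] at h
    linarith [mul_comm ‖x‖ ‖y‖]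
  refine ⟨hsum, B.opNorm_le_bound₂ hsum fun x y => ?_⟩
  have hexp : B x y = ∑ i, ∑ j, B (Pi.single i (x i)) (Pi.single j (y j)) := by
    conv_lhs => rw [← Finset.univ_sum_single x, ← Finset.univ_sum_single y]
    simp only [map_sum, sum_apply]
    exact Finset.sum_comm
  rw [hexp, Real.norm_eq_abs, mul_assoc, Finset.sum_mul]
  refine (Finset.abs_sum_le_sum_abs _ _).trans (Finset.sum_le_sum fun i _ => ?_)
  rw [Finset.sum_mul]
  refine (Finset.abs_sum_le_sum_abs _ _).trans (Finset.sum_le_sum fun j _ => ?_)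
  refine (hblock i j _ _).trans (mul_le_mul_of_nonneg_left ?_ (hK i j))
  exact mul_le_mul (norm_le_pi_norm x i) (norm_le_pi_norm y j) (norm_nonneg _) (norm_nonneg _)

lemma abs_sub_sub_fderiv_zero_le {F : Type*} [NormedAddCommGroup F] [NormedSpace ℝ F]
    {V : F → ℝ} {K : ℝ} (hV : ContDiff ℝ 2 V) (hK : 0 ≤ K)
    (hbound : ∀ g, ‖fderiv ℝ (fderiv ℝ V) g‖ ≤ K) (x y : F) :
    |V x - V y - fderiv ℝ V 0 (x - y)| ≤ K * (‖x‖ + ‖y‖) * ‖x - y‖ := by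
  have hd : Differentiable ℝ (fderiv ℝ V) :=
    (hV.fderiv_right (m := 1) (by norm_num)).differentiable (by norm_num)
  have hlip : ∀ z, ‖fderiv ℝ V z - fderiv ℝ V 0‖ ≤ K * ‖z‖ := fun z => by
    simpa using convex_univ.norm_image_sub_le_of_norm_fderiv_le (𝕜 := ℝ)
      (fun g _ => hd g) (fun g _ => hbound g) (Set.mem_univ 0) (Set.mem_univ z)
  refine (convex_closedBall (0 : F) (‖x‖ + ‖y‖)).norm_image_sub_le_of_norm_fderiv_le' (𝕜 := ℝ)
    (fun z _ => hV.differentiable (by norm_num) z) (fun z hz => ?_) (by simp) (by simp)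
  exact (hlip z).trans (mul_le_mul_of_nonneg_left (by simpa using hz) hK)

lemma pi_norm_sq_le_sum {ι E : Type*} [Fintype ι] [SeminormedAddCommGroup E] (x : ι → E) :
    ‖x‖ ^ 2 ≤ ∑ i, ‖x i‖ ^ 2 := by
  have hs : 0 ≤ ∑ i, ‖x i‖ ^ 2 := Finset.sum_nonneg fun i _ => sq_nonneg _
  rw [← Real.sq_sqrt hs]
  gcongr
  refine (pi_norm_le_iff_of_nonneg (Real.sqrt_nonneg _)).2 fun i => Real.le_sqrt_of_sq_le ?_
  exact Finset.single_le_sum (f := fun i => ‖x i‖ ^ 2) (fun i _ => sq_nonneg _) (Finset.mem_univ i)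

lemma sum_add_mul_le_sqrt {ι : Type*} (s : Finset ι) (a b c : ι → ℝ) :
    ∑ i ∈ s, (a i + b i) * c i ≤
      (√(∑ i ∈ s, a i ^ 2) + √(∑ i ∈ s, b i ^ 2)) * √(∑ i ∈ s, c i ^ 2) := by
  simp only [add_mul, Finset.sum_add_distrib]
  exact add_le_add (Real.sum_mul_le_sqrt_mul_sqrt s a c) (Real.sum_mul_le_sqrt_mul_sqrt s b c)

/-- **Lipschitz property of the atomistic energy** (Lemma 2.1 of the paper):
if `V ∈ C²` with `V(0) = 0` and bounded second partial derivatives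
(`M₂ = Σ_{i,j} sup ∂_{i,j}V`), then
`|Eᵃ(u) − Eᵃ(v)| ≤ C M₂ (‖Du‖_{ℓ²} + ‖Dv‖_{ℓ²}) ‖Du − Dv‖_{ℓ²}`
for all `u, v` with finitely supported difference fields. -/
theorem atomistic_energy_lipschitz (m : ℕ) :
    ∃ C : ℝ, 0 < C ∧
    ∀ (V : (Fin 6 → EuclideanSpace ℝ (Fin m)) → ℝ) (M₂ : ℝ),
      ContDiff ℝ 2 V → V 0 = 0 →
      (∃ Mij : Fin 6 → Fin 6 → ℝ,
        (∀ (i j : Fin 6) (g : Fin 6 → EuclideanSpace ℝ (Fin m))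
            (h₁ h₂ : EuclideanSpace ℝ (Fin m)), ‖h₁‖ = 1 → ‖h₂‖ = 1 →
          fderiv ℝ (fderiv ℝ V) g (Pi.single i h₁) (Pi.single j h₂) ≤ Mij i j) ∧
        ∑ i : Fin 6, ∑ j : Fin 6, Mij i j ≤ M₂) →
      ∀ u v : EuclideanSpace ℝ (Fin 2) → EuclideanSpace ℝ (Fin m),
        {p : ℤ × ℤ | (fun j => Dj u j (latPt p)) ≠ 0}.Finite →
        {p : ℤ × ℤ | (fun j => Dj v j (latPt p)) ≠ 0}.Finite →
        |Ea V u - Ea V v| ≤ C * M₂ *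
          (Real.sqrt (∑ᶠ p : ℤ × ℤ, ∑ j : Fin 6, ‖Dj u j (latPt p)‖ ^ 2) +
           Real.sqrt (∑ᶠ p : ℤ × ℤ, ∑ j : Fin 6, ‖Dj v j (latPt p)‖ ^ 2)) *
          Real.sqrt (∑ᶠ p : ℤ × ℤ, ∑ j : Fin 6, ‖Dj u j (latPt p) - Dj v j (latPt p)‖ ^ 2) := by
  refine ⟨1, one_pos, ?_⟩
  rintro V M₂ hV hV0 ⟨Mij, hMij, hM₂⟩ u v hu hv
  rcases m.eq_zero_or_pos with rfl | hm
  · have h0 : ∀ u : EuclideanSpace ℝ (Fin 2) → EuclideanSpace ℝ (Fin 0), Ea V u = 0 := fun u => by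
      have h : ∀ p, (fun j => Dj u j (latPt p)) = 0 := fun p => Subsingleton.elim _ _
      simp [Ea, h, hV0]
    have hn : ∀ x : EuclideanSpace ℝ (Fin 0), ‖x‖ = 0 := fun x => by
      rw [Subsingleton.elim x 0, norm_zero]
    simp [h0, hn]
  have : Nonempty (Fin m) := ⟨⟨0, hm⟩⟩
  have hM0 : 0 ≤ M₂ :=
    (norm_bilin_le_of_single_le _ Mij fun i j => hMij i j 0).1.trans hM₂
  have hHess : ∀ g, ‖fderiv ℝ (fderiv ℝ V) g‖ ≤ M₂ := fun g =>
    (norm_bilin_le_of_single_le _ Mij fun i j => hMij i j g).2.trans hM₂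
  let G (w : EuclideanSpace ℝ (Fin 2) → EuclideanSpace ℝ (Fin m)) (p : ℤ × ℤ) :
    Fin 6 → EuclideanSpace ℝ (Fin m) := fun j => Dj w j (latPt p)
  have hG : ∀ p, G (u - v) p = G u p - G v p := fun p => by
    ext1 j
    simp only [G, Dj, Pi.sub_apply]
    abel
  let S : Finset (ℤ × ℤ) := hu.toFinset ∪ hv.toFinset
  have hSu : ∀ p ∉ S, G u p = 0 := fun p hp => by
    by_contra h
    exact hp (Finset.mem_union_left _ (hu.mem_toFinset.2 h))
  have hSv : ∀ p ∉ S, G v p = 0 := fun p hp => by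
    by_contra h
    exact hp (Finset.mem_union_right _ (hv.mem_toFinset.2 h))
  have hSw : ∀ p ∉ S, G (u - v) p = 0 := fun p hp => by rw [hG, hSu p hp, hSv p hp, sub_zero]
  have hfin : ∀ {A : Type} [AddCommMonoid A] (f : ℤ × ℤ → A), (∀ p ∉ S, f p = 0) →
      ∑ᶠ p, f p = ∑ p ∈ S, f p := fun f hf =>
    finsum_eq_sum_of_support_subset f fun p hp => by
      by_contra h
      exact hp (hf p h)
  have hE : ∀ w, (∀ p ∉ S, G w p = 0) → Ea V w = ∑ p ∈ S, V (G w p) := fun w hw =>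
    hfin (fun p => V (G w p)) fun p hp => by rw [hw p hp, hV0]
  have hN : ∀ w, (∀ p ∉ S, G w p = 0) →
      ∑ᶠ p, ∑ j, ‖G w p j‖ ^ 2 = ∑ p ∈ S, √(∑ j, ‖G w p j‖ ^ 2) ^ 2 := fun w hw => by
    rw [hfin _ fun p hp => by simp [hw p hp]]
    exact Finset.sum_congr rfl fun p _ =>
      (Real.sq_sqrt (Finset.sum_nonneg fun j _ => sq_nonneg _)).symm
  have hlin : ∑ p ∈ S, G (u - v) p = 0 := by
    ext1 j
    rw [Finset.sum_apply, Pi.zero_apply, ← hfin _ fun p hp => congrFun (hSw p hp) j]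
    refine finsum_Dj_eq_zero (u - v) (S.finite_toSet.subset fun p hp => ?_) j
    by_contra h
    exact hp (hSw p h)
  have hEdiff : Ea V u - Ea V v =
      ∑ p ∈ S, (V (G u p) - V (G v p) - fderiv ℝ V 0 (G u p - G v p)) := by
    simp only [← hG]
    rw [Finset.sum_sub_distrib, Finset.sum_sub_distrib, ← map_sum, hlin, map_zero, sub_zero,
      hE u hSu, hE v hSv]
  have hnorm : ∀ x : Fin 6 → EuclideanSpace ℝ (Fin m), ‖x‖ ≤ √(∑ j, ‖x j‖ ^ 2) := fun x =>
    Real.le_sqrt_of_sq_le (pi_norm_sq_le_sum x)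
  have hNw := hN (u - v) hSw
  simp only [hG] at hNw
  rw [one_mul, hEdiff]
  change _ ≤ M₂ * (√(∑ᶠ p, ∑ j, ‖G u p j‖ ^ 2) + √(∑ᶠ p, ∑ j, ‖G v p j‖ ^ 2)) *
    √(∑ᶠ p, ∑ j, ‖(G u p - G v p) j‖ ^ 2)
  rw [hN u hSu, hN v hSv, hNw, mul_assoc]
  refine (Finset.abs_sum_le_sum_abs _ _).trans ?_
  refine le_trans ?_ (mul_le_mul_of_nonneg_left (sum_add_mul_le_sqrt S _ _ _) hM0)
  rw [Finset.mul_sum]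
  refine Finset.sum_le_sum fun p _ => ?_
  refine (abs_sub_sub_fderiv_zero_le hV hM0 hHess _ _).trans ?_
  rw [mul_assoc]
  gcongr <;> apply hnorm

end
end

section
/- Let c > 0. There exists a constant C = C(c) > 0 with the following property. Let T ⊂ ℝ² be a closed nondegenerate triangle with vertices v₁, v₂, v₃, diameter h_T := diam(T) and area |T|, satisfying the shape-regularity condition h_T² ≤ c|T|. Let v be three times continuously differentiable on a neighbourhood of T with values in ℝ^m, and let p : ℝ² → ℝ^m be a polynomial of total degree at most 2 (in each component) that agrees with v at the three vertices v₁, v₂, v₃ and at the three edge midpoints (v₁+v₂)/2, (v₂+v₃)/2, (v₁+v₃)/2. Then ‖∇v − ∇p‖_{L²(T)} ≤ C h_T² ‖∇³ v‖_{L²(T)}. -/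
open MeasureTheory
open scoped ENNReal

theorem sq_lintegral_le_lintegral_sq {α : Type*} [MeasurableSpace α] (μ : Measure α)
    [IsProbabilityMeasure μ] {f : α → ℝ≥0∞} (hf : AEMeasurable f μ) :
    (∫⁻ x, f x ∂μ) ^ 2 ≤ ∫⁻ x, f x ^ 2 ∂μ := by
  have h := ENNReal.lintegral_mul_le_Lp_mul_Lq μ Real.HolderConjugate.two_two hf
    (aemeasurable_const (b := (1 : ℝ≥0∞)))
  simp only [Pi.mul_apply, mul_one, ENNReal.one_rpow, lintegral_const, measure_univ] at h
  calc (∫⁻ x, f x ∂μ) ^ 2 ≤ ((∫⁻ x, f x ^ (2 : ℝ) ∂μ) ^ (1 / 2 : ℝ)) ^ 2 := by gcongr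
    _ = ∫⁻ x, f x ^ 2 ∂μ := by
      rw [← ENNReal.rpow_natCast, ← ENNReal.rpow_mul]
      simp

section Homothety

variable {E : Type*} [NormedAddCommGroup E] [NormedSpace ℝ E] [MeasurableSpace E] [BorelSpace E]
  [FiniteDimensional ℝ E] (μ : Measure E) [μ.IsAddHaarMeasure]

theorem lintegral_comp_add_smul_sub {f : E → ℝ≥0∞} (hf : Measurable f) (a : E) {t : ℝ}
    (ht : t < 1) :
    ∫⁻ x, f (x + t • (a - x)) ∂μ
      = ENNReal.ofReal ((1 - t) ^ Module.finrank ℝ E)⁻¹ * ∫⁻ x, f x ∂μ := by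
  have hr : 0 < 1 - t := sub_pos.2 ht
  have hx : ∀ x : E, x + t • (a - x) = (1 - t) • x + t • a := fun x => by module
  have hg : Measurable fun y => f (y + t • a) := hf.comp (measurable_add_const _)
  simp_rw [hx]
  rw [← lintegral_map (g := fun x : E => (1 - t) • x) hg (measurable_const_smul (1 - t))]
  have h := Measure.map_addHaar_smul μ hr.ne'
  rw [h, lintegral_smul_measure, lintegral_add_right_eq_self f, abs_of_pos (by positivity),
    smul_eq_mul]

theorem lintegral_sq_lintegral_segment_le (hE : Module.finrank ℝ E = 2) {f : E → ℝ≥0∞}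
    (hf : Measurable f) (a : E) :
    ∫⁻ x, (∫⁻ t in Set.Icc (0 : ℝ) 1, ENNReal.ofReal (1 - t) * f (x + t • (a - x))) ^ 2 ∂μ
      ≤ ∫⁻ x, f x ^ 2 ∂μ := by
  have : IsProbabilityMeasure (volume.restrict (Set.Icc (0 : ℝ) 1)) := ⟨by simp⟩
  have hm : Measurable fun q : E × ℝ => ENNReal.ofReal (1 - q.2) * f (q.1 + q.2 • (a - q.1)) := by
    fun_prop
  calc ∫⁻ x, (∫⁻ t in Set.Icc (0 : ℝ) 1, ENNReal.ofReal (1 - t) * f (x + t • (a - x))) ^ 2 ∂μ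
      ≤ ∫⁻ x, (∫⁻ t in Set.Icc (0 : ℝ) 1,
          (ENNReal.ofReal (1 - t) * f (x + t • (a - x))) ^ 2) ∂μ := by
        gcongr with x
        exact sq_lintegral_le_lintegral_sq _ (hm.comp measurable_prodMk_left).aemeasurable
    _ = ∫⁻ t in Set.Icc (0 : ℝ) 1, (∫⁻ x,
          (ENNReal.ofReal (1 - t) * f (x + t • (a - x))) ^ 2 ∂μ) :=
        lintegral_lintegral_swap (hm.pow_const 2).aemeasurable
    _ ≤ ∫⁻ _ in Set.Icc (0 : ℝ) 1, (∫⁻ x, f x ^ 2 ∂μ) := by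
        refine setLIntegral_mono measurable_const fun t ht => ?_
        rcases ht.2.eq_or_lt with rfl | h1
        · simp
        have hp : 0 < 1 - t := sub_pos.2 h1
        simp_rw [mul_pow]
        rw [lintegral_const_mul _ (by fun_prop),
          lintegral_comp_add_smul_sub μ (hf.pow_const 2) a h1, hE, ← mul_assoc,
          ← ENNReal.ofReal_pow hp.le, ← ENNReal.ofReal_mul (by positivity),
          mul_inv_cancel₀ (by positivity), ENNReal.ofReal_one, one_mul]
    _ = ∫⁻ x, f x ^ 2 ∂μ := by simp

end Homothety

section Taylor

set_option maxSynthPendingDepth 3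

variable {E F : Type*} [NormedAddCommGroup E] [NormedSpace ℝ E] [NormedAddCommGroup F]
  [NormedSpace ℝ F]

theorem norm_iteratedFDeriv_three (f : E → F) (x : E) :
    ‖iteratedFDeriv ℝ 3 f x‖ = ‖fderiv ℝ (fderiv ℝ (fderiv ℝ f)) x‖ := by
  rw [← norm_iteratedFDeriv_fderiv, ← norm_iteratedFDeriv_fderiv, norm_iteratedFDeriv_one]

theorem enorm_taylor_two_remainder_le [CompleteSpace F] {f : E → F} {U : Set E} (hU : IsOpen U)
    (hf : ContDiffOn ℝ 3 f U) {x z : E} (hxz : ∀ t ∈ Set.Icc (0 : ℝ) 1, x + t • z ∈ U) :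
    ‖f (x + z) - f x - fderiv ℝ f x z - (2⁻¹ : ℝ) • fderiv ℝ (fderiv ℝ f) x z z‖ₑ
      ≤ ENNReal.ofReal (‖z‖ ^ 3) * ∫⁻ t in Set.Icc (0 : ℝ) 1,
          ENNReal.ofReal (1 - t) * ‖iteratedFDeriv ℝ 3 f (x + t • z)‖ₑ := by
  have hf1 : ContDiffOn ℝ 2 (fderiv ℝ f) U := hf.fderiv_of_isOpen hU (by norm_num)
  have hf2 : ContDiffOn ℝ 1 (fderiv ℝ (fderiv ℝ f)) U := hf1.fderiv_of_isOpen hU (by norm_num)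
  have hf3 : ContinuousOn (fderiv ℝ (fderiv ℝ (fderiv ℝ f))) U :=
    hf2.continuousOn_fderiv_of_isOpen hU le_rfl
  have hγ : ∀ t : ℝ, HasDerivAt (fun t : ℝ => x + t • z) z t := fun t => by
    simpa using ((hasDerivAt_id t).smul_const z).const_add x
  have hγc : Continuous fun t : ℝ => x + t • z := by fun_prop
  let g : ℝ → F := fun t => f (x + t • z) + (1 - t) • fderiv ℝ f (x + t • z) z
    + ((1 - t) ^ 2 / 2) • fderiv ℝ (fderiv ℝ f) (x + t • z) z z
  let g' : ℝ → F := fun t =>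
    ((1 - t) ^ 2 / 2) • fderiv ℝ (fderiv ℝ (fderiv ℝ f)) (x + t • z) z z z
  have hg : ∀ t ∈ Set.uIcc (0 : ℝ) 1, HasDerivAt g (g' t) t := by
    intro t ht
    rw [Set.uIcc_of_le zero_le_one] at ht
    have hUn := hU.mem_nhds (hxz t ht)
    have d0 : HasDerivAt (fun t : ℝ => f (x + t • z)) _ t :=
      ((hf.contDiffAt hUn).differentiableAt (by norm_num)).hasFDerivAt.comp_hasDerivAt t (hγ t)
    have d1 : HasDerivAt (fun t : ℝ => fderiv ℝ f (x + t • z)) _ t :=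
      ((hf1.contDiffAt hUn).differentiableAt (by norm_num)).hasFDerivAt.comp_hasDerivAt t (hγ t)
    have d2 : HasDerivAt (fun t : ℝ => fderiv ℝ (fderiv ℝ f) (x + t • z)) _ t :=
      ((hf2.contDiffAt hUn).differentiableAt (by norm_num)).hasFDerivAt.comp_hasDerivAt t (hγ t)
    have e1 := d1.clm_apply (hasDerivAt_const t z)
    have e2 := (d2.clm_apply (hasDerivAt_const t z)).clm_apply (hasDerivAt_const t z)
    have s1 : HasDerivAt (fun t : ℝ => 1 - t) (-1) t := by
      simpa using (hasDerivAt_id t).const_sub 1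
    have s2 : HasDerivAt (fun t : ℝ => (1 - t) ^ 2 / 2) (-(1 - t)) t := by
      refine ((s1.pow 2).div_const 2).congr_deriv ?_
      push_cast
      ring
    refine ((d0.add (s1.smul e1)).add (s2.smul e2)).congr_deriv ?_
    simp only [g', map_zero, add_zero]
    module
  have hg'c : ContinuousOn g' (Set.uIcc 0 1) := by
    rw [Set.uIcc_of_le zero_le_one]
    have h3 : ContinuousOn (fun t : ℝ => fderiv ℝ (fderiv ℝ (fderiv ℝ f)) (x + t • z))
        (Set.Icc 0 1) := hf3.comp hγc.continuousOn hxz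
    have hs : ContinuousOn (fun t : ℝ => (1 - t) ^ 2 / 2) (Set.Icc 0 1) := by fun_prop
    exact hs.smul (((h3.clm_apply continuousOn_const).clm_apply continuousOn_const).clm_apply
      continuousOn_const)
  have hint := intervalIntegral.integral_eq_sub_of_hasDerivAt hg hg'c.intervalIntegrable
  have hrem : f (x + z) - f x - fderiv ℝ f x z - (2⁻¹ : ℝ) • fderiv ℝ (fderiv ℝ f) x z z
      = ∫ t in Set.Ioc (0 : ℝ) 1, g' t := by
    rw [← intervalIntegral.integral_of_le zero_le_one, hint]
    simp only [g, one_smul, sub_self, zero_smul, add_zero]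
    norm_num
    module
  rw [hrem, ← integral_Icc_eq_integral_Ioc, ← lintegral_const_mul' _ _ ENNReal.ofReal_ne_top]
  refine (enorm_integral_le_lintegral_enorm _).trans
    (setLIntegral_mono' measurableSet_Icc fun t ht => ?_)
  have h1t : 0 ≤ 1 - t := sub_nonneg.2 ht.2
  rw [← ofReal_norm, ← ofReal_norm, ← ENNReal.ofReal_mul h1t, ← ENNReal.ofReal_mul (by positivity)]
  refine ENNReal.ofReal_le_ofReal ?_
  rw [norm_iteratedFDeriv_three, norm_smul, Real.norm_of_nonneg (by positivity)]
  set D := fderiv ℝ (fderiv ℝ (fderiv ℝ f)) (x + t • z)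
  have hD : ‖D z z z‖ ≤ ‖D‖ * ‖z‖ * ‖z‖ * ‖z‖ := by
    refine ((D z z).le_opNorm z).trans ?_
    gcongr
    refine ((D z).le_opNorm z).trans ?_
    gcongr
    exact D.le_opNorm z
  calc (1 - t) ^ 2 / 2 * ‖D z z z‖ ≤ (1 - t) * (‖D‖ * ‖z‖ * ‖z‖ * ‖z‖) := by
        gcongr
        nlinarith [ht.1]
    _ = ‖z‖ ^ 3 * ((1 - t) * ‖D‖) := by ring

end Taylor

theorem exists_eq_add_smul_of_mem_triangle {E : Type*} [AddCommGroup E] [Module ℝ E]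
    {a b c x : E} (hx : x ∈ convexHull ℝ {a, b, c}) :
    ∃ s t : ℝ, 0 ≤ s ∧ 0 ≤ t ∧ s + t ≤ 1 ∧ x = a + s • (b - a) + t • (c - a) := by
  rw [convexHull_insert (by simp), convexHull_pair, mem_convexJoin] at hx
  obtain ⟨_, rfl, y, ⟨p, q, hp, hq, hpq, rfl⟩, r, k, hr, hk, hrk, rfl⟩ := hx
  refine ⟨k * p, k * q, by positivity, by positivity, by
    rw [← mul_add, hpq]; linarith, ?_⟩
  obtain rfl : p = 1 - q := by linarith
  obtain rfl : r = 1 - k := by linarith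
  module

section Interpolation

set_option maxSynthPendingDepth 3

variable {E F : Type*} [NormedAddCommGroup E] [NormedSpace ℝ E] [NormedAddCommGroup F]
  [NormedSpace ℝ F]

/-- The vertices and edge midpoints of the triangle with vertices `a`, `b`, `c`. -/
noncomputable def p2Nodes (a b c : E) : Fin 6 → E :=
  ![a, b, c, midpoint ℝ a b, midpoint ℝ b c, midpoint ℝ a c]

/-- The derivatives of the quadratic Lagrange basis functions attached to `p2Nodes`, at the point
with barycentric coordinates `(1 - s - t, s, t)` and in a direction along which these coordinates
vary at the rates `(-(α + β), α, β)`. -/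
noncomputable def p2BasisDeriv (s t α β : ℝ) : Fin 6 → ℝ :=
  ![-((4 * (1 - s - t) - 1) * (α + β)), (4 * s - 1) * α, (4 * t - 1) * β,
    4 * ((1 - s - t) * α - s * (α + β)), 4 * (s * β + t * α),
    4 * ((1 - s - t) * β - t * (α + β))]

theorem abs_p2BasisDeriv_le {s t α β M : ℝ} (hs : 0 ≤ s) (ht : 0 ≤ t) (hst : s + t ≤ 1)
    (hα : |α| ≤ M) (hβ : |β| ≤ M) (i : Fin 6) : |p2BasisDeriv s t α β i| ≤ 8 * M := by
  obtain ⟨hα1, hα2⟩ := abs_le.1 hα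
  obtain ⟨hβ1, hβ2⟩ := abs_le.1 hβ
  have hr : 0 ≤ 1 - s - t := by linarith
  have a1 := mul_nonneg hs (sub_nonneg.2 hα2)
  have a2 := mul_nonneg hs (neg_le_iff_add_nonneg.1 hα1)
  have a3 := mul_nonneg hs (sub_nonneg.2 hβ2)
  have a4 := mul_nonneg hs (neg_le_iff_add_nonneg.1 hβ1)
  have b1 := mul_nonneg ht (sub_nonneg.2 hα2)
  have b2 := mul_nonneg ht (neg_le_iff_add_nonneg.1 hα1)
  have b3 := mul_nonneg ht (sub_nonneg.2 hβ2)
  have b4 := mul_nonneg ht (neg_le_iff_add_nonneg.1 hβ1)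
  have c1 := mul_nonneg hr (sub_nonneg.2 hα2)
  have c2 := mul_nonneg hr (neg_le_iff_add_nonneg.1 hα1)
  have c3 := mul_nonneg hr (sub_nonneg.2 hβ2)
  have c4 := mul_nonneg hr (neg_le_iff_add_nonneg.1 hβ1)
  rw [abs_le]
  fin_cases i <;> simp [p2BasisDeriv] <;> constructor <;> nlinarith

theorem sum_p2BasisDeriv_smul_quadratic (A : F) (L : E →L[ℝ] F) (B : E →L[ℝ] E →L[ℝ] F)
    (a b c : E) (s t α β : ℝ) {x : E} (hx : x = a + s • (b - a) + t • (c - a)) :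
    L (α • (b - a) + β • (c - a)) = ∑ i, p2BasisDeriv s t α β i •
      (A + L (p2Nodes a b c i - x) + B (p2Nodes a b c i - x) (p2Nodes a b c i - x)) := by
  obtain ⟨u, rfl⟩ : ∃ u, b = a + u := ⟨b - a, by abel⟩
  obtain ⟨w, rfl⟩ : ∃ w, c = a + w := ⟨c - a, by abel⟩
  simp only [add_sub_cancel_left] at hx ⊢
  have h0 : a - x = (-s) • u + (-t) • w := by rw [hx]; module
  have h1 : a + u - x = (1 - s) • u + (-t) • w := by rw [hx]; module
  have h2 : a + w - x = (-s) • u + (1 - t) • w := by rw [hx]; module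
  have h3 : midpoint ℝ a (a + u) - x = (1 / 2 - s) • u + (-t) • w := by
    rw [hx, midpoint_eq_smul_add, invOf_eq_inv]; module
  have h4 : midpoint ℝ (a + u) (a + w) - x = (1 / 2 - s) • u + (1 / 2 - t) • w := by
    rw [hx, midpoint_eq_smul_add, invOf_eq_inv]; module
  have h5 : midpoint ℝ a (a + w) - x = (-s) • u + (1 / 2 - t) • w := by
    rw [hx, midpoint_eq_smul_add, invOf_eq_inv]; module
  simp only [Fin.sum_univ_six, p2Nodes, p2BasisDeriv, Matrix.cons_val, h0, h1, h2, h3, h4, h5,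
    map_add, map_smul, _root_.add_apply, _root_.smul_apply]
  module

theorem norm_le_sum_norm_p2Nodes (A : F) (L : E →L[ℝ] F) (B : E →L[ℝ] E →L[ℝ] F)
    (a b c : E) {s t K : ℝ} (hs : 0 ≤ s) (ht : 0 ≤ t) (hst : s + t ≤ 1) (hK : 0 ≤ K)
    {x : E} (hx : x = a + s • (b - a) + t • (c - a))
    (hcoord : ∀ d : E, ∃ α β : ℝ, d = α • (b - a) + β • (c - a) ∧
      |α| ≤ K * ‖d‖ ∧ |β| ≤ K * ‖d‖) :
    ‖L‖ ≤ 8 * K * ∑ i,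
      ‖A + L (p2Nodes a b c i - x) + B (p2Nodes a b c i - x) (p2Nodes a b c i - x)‖ := by
  refine L.opNorm_le_bound (by positivity) fun d => ?_
  obtain ⟨α, β, hd, hα, hβ⟩ := hcoord d
  conv_lhs => rw [hd, sum_p2BasisDeriv_smul_quadratic A L B a b c s t α β hx]
  rw [mul_right_comm, Finset.mul_sum]
  refine norm_sum_le_of_le _ fun i _ => ?_
  rw [norm_smul, Real.norm_eq_abs]
  gcongr
  simpa [mul_assoc] using abs_p2BasisDeriv_le hs ht hst hα hβ i

theorem p2Nodes_mem_convexHull (a b c : E) (i : Fin 6) :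
    p2Nodes a b c i ∈ convexHull ℝ {a, b, c} := by
  have ha : a ∈ convexHull ℝ {a, b, c} := subset_convexHull ℝ _ (by simp)
  have hb : b ∈ convexHull ℝ {a, b, c} := subset_convexHull ℝ _ (by simp)
  have hc : c ∈ convexHull ℝ {a, b, c} := subset_convexHull ℝ _ (by simp)
  have hconv := convex_convexHull ℝ {a, b, c}
  fin_cases i
  exacts [ha, hb, hc, hconv.midpoint_mem ha hb, hconv.midpoint_mem hb hc,
    hconv.midpoint_mem ha hc]

theorem hasFDerivAt_quadratic (c₀ : F) (l : E →L[ℝ] F) (Q : E →L[ℝ] E →L[ℝ] F) (x : E) :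
    HasFDerivAt (fun y => c₀ + l y + Q y y) (l + (Q x + Q.flip x)) x := by
  have h := (l.hasFDerivAt (x := x)).const_add c₀ |>.add
    ((Q.hasFDerivAt (x := x)).clm_apply (hasFDerivAt_id x))
  refine h.congr_fderiv ?_
  ext y
  simp

theorem enorm_fderiv_sub_fderiv_quadratic_le [CompleteSpace F] {f : E → F} {U : Set E}
    (hU : IsOpen U) (hf : ContDiffOn ℝ 3 f U) {a b c : E}
    (hTU : convexHull ℝ {a, b, c} ⊆ U) (c₀ : F) (l : E →L[ℝ] F) (Q : E →L[ℝ] E →L[ℝ] F)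
    (hp : ∀ i, c₀ + l (p2Nodes a b c i) + Q (p2Nodes a b c i) (p2Nodes a b c i)
      = f (p2Nodes a b c i)) {x : E} (hx : x ∈ convexHull ℝ {a, b, c}) {K h : ℝ} (hK : 0 ≤ K)
    (hh : ∀ i, ‖p2Nodes a b c i - x‖ ≤ h)
    (hcoord : ∀ d : E, ∃ α β : ℝ, d = α • (b - a) + β • (c - a) ∧
      |α| ≤ K * ‖d‖ ∧ |β| ≤ K * ‖d‖) :
    ‖fderiv ℝ f x - fderiv ℝ (fun y => c₀ + l y + Q y y) x‖ₑ
      ≤ ENNReal.ofReal (8 * K * h ^ 3) * ∑ i, ∫⁻ t in Set.Icc (0 : ℝ) 1, ENNReal.ofReal (1 - t) *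
          (convexHull ℝ {a, b, c}).indicator (fun y => ‖iteratedFDeriv ℝ 3 f y‖ₑ)
            (x + t • (p2Nodes a b c i - x)) := by
  obtain ⟨s, t, hs, ht, hst, hxst⟩ := exists_eq_add_smul_of_mem_triangle hx
  have hseg : ∀ i, ∀ t ∈ Set.Icc (0 : ℝ) 1,
      x + t • (p2Nodes a b c i - x) ∈ convexHull ℝ {a, b, c} := fun i t ht =>
    (convex_convexHull ℝ _).add_smul_sub_mem hx (p2Nodes_mem_convexHull a b c i) ht
  have h0 : 0 ≤ h := (norm_nonneg _).trans (hh 0)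
  have key := norm_le_sum_norm_p2Nodes (f x - (c₀ + l x + Q x x))
    (fderiv ℝ f x - fderiv ℝ (fun y => c₀ + l y + Q y y) x)
    ((2⁻¹ : ℝ) • fderiv ℝ (fderiv ℝ f) x - Q) a b c hs ht hst hK hxst hcoord
  rw [← ofReal_norm]
  refine (ENNReal.ofReal_le_ofReal key).trans ?_
  rw [ENNReal.ofReal_mul (by positivity), ENNReal.ofReal_mul (p := 8 * K) (by positivity),
    mul_assoc, ENNReal.ofReal_sum_of_nonneg fun _ _ => norm_nonneg _]
  gcongr ENNReal.ofReal (8 * K) * ?_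
  rw [Finset.mul_sum]
  gcongr with i
  rw [ofReal_norm]
  have hrem := enorm_taylor_two_remainder_le hU hf (z := p2Nodes a b c i - x)
    fun t ht => hTU (hseg i t ht)
  rw [← enorm_neg] at hrem
  have heq : f x - (c₀ + l x + Q x x)
      + (fderiv ℝ f x - fderiv ℝ (fun y => c₀ + l y + Q y y) x) (p2Nodes a b c i - x)
      + ((2⁻¹ : ℝ) • fderiv ℝ (fderiv ℝ f) x - Q) (p2Nodes a b c i - x) (p2Nodes a b c i - x)
      = -(f (x + (p2Nodes a b c i - x)) - f x - fderiv ℝ f x (p2Nodes a b c i - x)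
        - (2⁻¹ : ℝ) • fderiv ℝ (fderiv ℝ f) x (p2Nodes a b c i - x) (p2Nodes a b c i - x)) := by
    rw [add_sub_cancel, ← hp i, (hasFDerivAt_quadratic c₀ l Q x).fderiv]
    simp only [_root_.sub_apply, _root_.add_apply, _root_.smul_apply,
      ContinuousLinearMap.flip_apply, map_sub]
    module
  rw [heq]
  refine hrem.trans ?_
  gcongr ?_ * ?_
  · gcongr
    exact hh i
  · refine (setLIntegral_congr_fun measurableSet_Icc fun t ht => ?_).le
    simp only [Set.indicator_of_mem (hseg i t ht)]

end Interpolation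

section Triangle

theorem abs_cross_le (d w : EuclideanSpace ℝ (Fin 2)) :
    |d 0 * w 1 - d 1 * w 0| ≤ ‖d‖ * ‖w‖ := by
  refine abs_le_of_sq_le_sq ?_ (by positivity)
  rw [mul_pow, EuclideanSpace.real_norm_sq_eq, EuclideanSpace.real_norm_sq_eq]
  simp only [Fin.sum_univ_two]
  nlinarith [sq_nonneg (d 0 * w 0 + d 1 * w 1)]

theorem exists_coord_of_cross_ne_zero {u w : EuclideanSpace ℝ (Fin 2)} {h : ℝ}
    (hD : u 0 * w 1 - u 1 * w 0 ≠ 0) (hu : ‖u‖ ≤ h) (hw : ‖w‖ ≤ h)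
    (d : EuclideanSpace ℝ (Fin 2)) :
    ∃ α β : ℝ, d = α • u + β • w ∧ |α| ≤ h / |u 0 * w 1 - u 1 * w 0| * ‖d‖ ∧
      |β| ≤ h / |u 0 * w 1 - u 1 * w 0| * ‖d‖ := by
  refine ⟨(d 0 * w 1 - d 1 * w 0) / (u 0 * w 1 - u 1 * w 0),
    (u 0 * d 1 - u 1 * d 0) / (u 0 * w 1 - u 1 * w 0), ?_, ?_, ?_⟩
  · ext i
    fin_cases i <;> simp <;>
      rw [div_mul_eq_mul_div, div_mul_eq_mul_div, ← add_div, eq_div_iff hD] <;> ring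
  · rw [abs_div, div_mul_eq_mul_div, mul_comm h]
    gcongr
    exact (abs_cross_le d w).trans (by gcongr)
  · rw [abs_div, div_mul_eq_mul_div]
    gcongr
    exact (abs_cross_le u d).trans (by gcongr)

theorem volume_triangle_le (a b c : EuclideanSpace ℝ (Fin 2)) :
    (volume (convexHull ℝ {a, b, c})).toReal
      ≤ |(b - a) 0 * (c - a) 1 - (b - a) 1 * (c - a) 0| := by
  have hsub : convexHull ℝ {a, b, c} ⊆ (fun y => a + y) '' parallelepiped ![b - a, c - a] := by
    intro x hx
    obtain ⟨s, t, hs, ht, hst, rfl⟩ := exists_eq_add_smul_of_mem_triangle hx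
    refine ⟨s • (b - a) + t • (c - a), ?_, by simp only [add_assoc]⟩
    rw [mem_parallelepiped_iff]
    refine ⟨![s, t], ⟨fun i => ?_, fun i => ?_⟩, by simp⟩ <;> fin_cases i <;> simp <;> linarith
  have hvol : volume (parallelepiped ![b - a, c - a])
      = ENNReal.ofReal |(b - a) 0 * (c - a) 1 - (b - a) 1 * (c - a) 0| := by
    rw [← (EuclideanSpace.basisFun (Fin 2) ℝ).addHaar_eq_volume, Measure.addHaar_parallelepiped,
      Module.Basis.det_apply, Matrix.det_fin_two]
    simp [Module.Basis.toMatrix_apply]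
    ring_nf
  refine ENNReal.toReal_le_of_le_ofReal (abs_nonneg _) ?_
  calc volume (convexHull ℝ {a, b, c})
      ≤ volume ((fun y => a + y) '' parallelepiped ![b - a, c - a]) :=
        measure_mono hsub
    _ = _ := by rw [Set.image_add_left, measure_preimage_add, hvol]

end Triangle

theorem eLpNorm_two_le_of_lintegral_sq_le {α F G : Type*} [MeasurableSpace α] {μ : Measure α}
    [NormedAddCommGroup F] [NormedAddCommGroup G] {f : α → F} {g : α → G} {κ : ℝ≥0∞}
    (h : ∫⁻ x, ‖f x‖ₑ ^ 2 ∂μ ≤ κ ^ 2 * ∫⁻ x, ‖g x‖ₑ ^ 2 ∂μ) :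
    eLpNorm f 2 μ ≤ κ * eLpNorm g 2 μ := by
  rw [eLpNorm_eq_lintegral_rpow_enorm_toReal two_ne_zero ENNReal.ofNat_ne_top,
    eLpNorm_eq_lintegral_rpow_enorm_toReal two_ne_zero ENNReal.ofNat_ne_top]
  simp only [ENNReal.toReal_ofNat, ENNReal.rpow_two]
  refine (ENNReal.rpow_le_rpow h (by norm_num)).trans_eq ?_
  rw [ENNReal.mul_rpow_of_nonneg _ _ (by norm_num), ← ENNReal.rpow_two, ← ENNReal.rpow_mul]
  norm_num

theorem sq_sum_le_six_mul_sum_sq (f : Fin 6 → ℝ≥0∞) : (∑ i, f i) ^ 2 ≤ 6 * ∑ i, f i ^ 2 := by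
  have h := ENNReal.rpow_sum_le_const_mul_sum_rpow (Finset.univ) f (p := 2) (by norm_num)
  norm_num at h
  exact h


/-- **P2 interpolation error estimate on a shape-regular triangle** (Lemma 6.2(a) of the
paper, via the Bramble–Hilbert lemma): if `T = conv{v₁,v₂,v₃}` is a nondegenerate triangle
with `diam(T)² ≤ c|T|`, `v` is `C³` on a neighbourhood of `T`, and `p` is a polynomial of
total degree ≤ 2 interpolating `v` at the vertices and edge midpoints of `T`, then
`‖∇v − ∇p‖_{L²(T)} ≤ C h_T² ‖∇³v‖_{L²(T)}` with `C = C(c)`. -/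
theorem p2_interpolation_error (c : ℝ) (hc : 0 < c) :
    ∃ C : ℝ, 0 < C ∧
    ∀ (m : ℕ) (v₁ v₂ v₃ : EuclideanSpace ℝ (Fin 2)),
      AffineIndependent ℝ ![v₁, v₂, v₃] →
      ∀ T : Set (EuclideanSpace ℝ (Fin 2)), T = convexHull ℝ {v₁, v₂, v₃} →
      Metric.diam T ^ 2 ≤ c * (volume T).toReal →
      ∀ (v p : EuclideanSpace ℝ (Fin 2) → EuclideanSpace ℝ (Fin m))
        (U : Set (EuclideanSpace ℝ (Fin 2))),
        IsOpen U → T ⊆ U → ContDiffOn ℝ 3 v U →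
        (∃ (c₀ : EuclideanSpace ℝ (Fin m))
            (l : EuclideanSpace ℝ (Fin 2) →ₗ[ℝ] EuclideanSpace ℝ (Fin m))
            (quad : EuclideanSpace ℝ (Fin 2) →ₗ[ℝ]
              EuclideanSpace ℝ (Fin 2) →ₗ[ℝ] EuclideanSpace ℝ (Fin m)),
            ∀ x, p x = c₀ + l x + quad x x) →
        p v₁ = v v₁ → p v₂ = v v₂ → p v₃ = v v₃ →
        p (midpoint ℝ v₁ v₂) = v (midpoint ℝ v₁ v₂) →
        p (midpoint ℝ v₂ v₃) = v (midpoint ℝ v₂ v₃) →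
        p (midpoint ℝ v₁ v₃) = v (midpoint ℝ v₁ v₃) →
        eLpNorm (fun x => fderiv ℝ v x - fderiv ℝ p x) 2 (volume.restrict T)
          ≤ ENNReal.ofReal (C * Metric.diam T ^ 2) *
              eLpNorm (iteratedFDeriv ℝ 3 v) 2 (volume.restrict T) := by
  refine ⟨48 * c, by positivity, ?_⟩
  rintro m v₁ v₂ v₃ hind T rfl hreg v p U hU hTU hv ⟨c₀, l₀, q₀, hp⟩ h1 h2 h3 h12 h23 h13
  let l := LinearMap.toContinuousLinearMap l₀
  let Q := LinearMap.toContinuousLinearMap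
    ((LinearMap.toContinuousLinearMap (𝕜 := ℝ) (E := EuclideanSpace ℝ (Fin 2))
      (F' := EuclideanSpace ℝ (Fin m))).toLinearMap ∘ₗ q₀)
  obtain rfl : p = fun y => c₀ + l y + Q y y := funext hp
  have hnodes : ∀ i, c₀ + l (p2Nodes v₁ v₂ v₃ i) + Q (p2Nodes v₁ v₂ v₃ i) (p2Nodes v₁ v₂ v₃ i)
      = v (p2Nodes v₁ v₂ v₃ i) := by
    intro i
    fin_cases i
    exacts [h1, h2, h3, h12, h23, h13]
  have hcpt : IsCompact (convexHull ℝ {v₁, v₂, v₃}) := (Set.toFinite _).isCompact_convexHull ℝ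
  set T := convexHull ℝ {v₁, v₂, v₃}
  set h := Metric.diam T
  have hdist : ∀ {y z}, y ∈ T → z ∈ T → ‖y - z‖ ≤ h := fun hy hz => by
    rw [← dist_eq_norm]
    exact Metric.dist_le_diam_of_mem hcpt.isBounded hy hz
  have hn := p2Nodes_mem_convexHull v₁ v₂ v₃
  have hcD := hreg.trans (mul_le_mul_of_nonneg_left (volume_triangle_le v₁ v₂ v₃) hc.le)
  set D := (v₂ - v₁) 0 * (v₃ - v₁) 1 - (v₂ - v₁) 1 * (v₃ - v₁) 0
  have hD : D ≠ 0 := by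
    intro h0
    rw [h0, abs_zero, mul_zero] at hcD
    have hh0 : h = 0 := pow_eq_zero_iff two_ne_zero |>.1 (le_antisymm hcD (sq_nonneg _))
    have h21 := hdist (hn 1) (hn 0)
    rw [hh0, norm_le_zero_iff, sub_eq_zero] at h21
    exact absurd (hind.injective (a₁ := 1) (a₂ := 0) h21) (by decide)
  set g : EuclideanSpace ℝ (Fin 2) → ℝ≥0∞ := T.indicator fun y => ‖iteratedFDeriv ℝ 3 v y‖ₑ
  have hg : Measurable g := by
    have hcont : ContinuousOn (fun y => ‖iteratedFDeriv ℝ 3 v y‖ₑ) T :=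
      ((hv.continuousOn_iteratedFDerivWithin le_rfl hU.uniqueDiffOn).congr fun y hy =>
        (iteratedFDerivWithin_of_isOpen 3 hU hy).symm).mono hTU |>.enorm
    classical
    change Measurable (T.indicator _)
    rw [← Set.piecewise_eq_indicator]
    exact hcont.measurable_piecewise continuousOn_const hcpt.isClosed.measurableSet
  set N : Fin 6 → EuclideanSpace ℝ (Fin 2) → ℝ≥0∞ := fun i x =>
    ∫⁻ t in Set.Icc (0 : ℝ) 1, ENNReal.ofReal (1 - t) * g (x + t • (p2Nodes v₁ v₂ v₃ i - x))
  have hN : ∀ i, Measurable (N i) := fun i => by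
    refine Measurable.lintegral_prod_right' (f := fun q : EuclideanSpace ℝ (Fin 2) × ℝ =>
      ENNReal.ofReal (1 - q.2) * g (q.1 + q.2 • (p2Nodes v₁ v₂ v₃ i - q.1))) ?_
    fun_prop
  have hpt : ∀ x ∈ T, ‖fderiv ℝ v x - fderiv ℝ (fun y => c₀ + l y + Q y y) x‖ₑ
      ≤ ENNReal.ofReal (8 * c * h ^ 2) * ∑ i, N i x := by
    intro x hx
    refine (enorm_fderiv_sub_fderiv_quadratic_le hU hv hTU c₀ l Q hnodes hx (K := h / |D|)
      (by positivity) (fun i => hdist (hn i) hx)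
      (exists_coord_of_cross_ne_zero hD (hdist (hn 1) (hn 0)) (hdist (hn 2) (hn 0)))).trans ?_
    gcongr ENNReal.ofReal ?_ * _
    have hD' : 0 < |D| := abs_pos.2 hD
    calc 8 * (h / |D|) * h ^ 3 = 8 * (h ^ 2 / |D|) * h ^ 2 := by ring
      _ ≤ 8 * c * h ^ 2 := by
        gcongr
        rwa [div_le_iff₀ hD']
  have hκ : ENNReal.ofReal (48 * c * h ^ 2) = 6 * ENNReal.ofReal (8 * c * h ^ 2) := by
    rw [← ENNReal.ofReal_ofNat, ← ENNReal.ofReal_mul (by norm_num)]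
    congr 1
    ring
  rw [hκ]
  refine eLpNorm_two_le_of_lintegral_sq_le ?_
  set κ := ENNReal.ofReal (8 * c * h ^ 2)
  calc ∫⁻ x in T, ‖fderiv ℝ v x - fderiv ℝ (fun y => c₀ + l y + Q y y) x‖ₑ ^ 2
      ≤ ∫⁻ x in T, κ ^ 2 * (6 * ∑ i, N i x ^ 2) := by
        refine setLIntegral_mono' hcpt.isClosed.measurableSet fun x hx => ?_
        refine (pow_le_pow_left' (hpt x hx) 2).trans ?_
        rw [mul_pow]
        gcongr
        exact sq_sum_le_six_mul_sum_sq _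
    _ ≤ ∫⁻ x, κ ^ 2 * (6 * ∑ i, N i x ^ 2) := setLIntegral_le_lintegral _ _
    _ = κ ^ 2 * (6 * ∑ i, ∫⁻ x, N i x ^ 2) := by
        rw [lintegral_const_mul _ (by fun_prop), lintegral_const_mul _ (by fun_prop),
          lintegral_finsetSum _ fun i _ => (hN i).pow_const 2]
    _ ≤ κ ^ 2 * (6 * ∑ _i : Fin 6, ∫⁻ x, g x ^ 2) := by
        gcongr κ ^ 2 * (6 * ∑ i, ?_) with i
        exact lintegral_sq_lintegral_segment_le volume (by simp) hg _
    _ = (6 * κ) ^ 2 * ∫⁻ x in T, ‖iteratedFDeriv ℝ 3 v x‖ₑ ^ 2 := by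
        have hgT : ∫⁻ x, g x ^ 2 = ∫⁻ x in T, ‖iteratedFDeriv ℝ 3 v x‖ₑ ^ 2 := by
          rw [← lintegral_indicator hcpt.isClosed.measurableSet]
          congr 1 with x
          by_cases hx : x ∈ T <;> simp [g, hx]
        rw [hgT]
        simp only [Finset.sum_const, Finset.card_univ, Fintype.card_fin, nsmul_eq_mul]
        push_cast
        ring
end

section
/- Let μ ∈ C¹(ℝ) satisfy μ(t) = 1 for 0 ≤ t ≤ 1/2 and μ(t) = 0 for t ≥ 1. Then there exists a constant C > 0, depending only on μ, such that for every N > 0, every continuously differentiable u : ℝ² → ℝ^m, and every measurable set S ⊇ B_N, the truncated function Lu(x) := μ(|x|/N)(u(x) − a), where a := (1/|B_N ∖ B_{N/2}|) ∫_{B_N ∖ B_{N/2}} u(y) dy, satisfies ‖∇(Lu) − ∇u‖_{L²(S)} ≤ C ‖∇u‖_{L²(S ∖ B_{N/2})}. -/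
open MeasureTheory

open scoped ENNReal in
theorem ENNReal.sq_lintegral_le {α : Type*} [MeasurableSpace α] (ν : Measure α) {f : α → ℝ≥0∞}
    (hf : AEMeasurable f ν) : (∫⁻ x, f x ∂ν) ^ 2 ≤ ν Set.univ * ∫⁻ x, f x ^ 2 ∂ν := by
  have h := ENNReal.lintegral_mul_le_Lp_mul_Lq ν Real.HolderConjugate.two_two
    (aemeasurable_const (b := (1 : ℝ≥0∞))) hf
  simp only [Pi.mul_apply, one_mul, lintegral_const, one_pow, ENNReal.rpow_two] at h
  calc (∫⁻ x, f x ∂ν) ^ 2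
      ≤ (ν Set.univ ^ (1 / 2 : ℝ) * (∫⁻ x, f x ^ 2 ∂ν) ^ (1 / 2 : ℝ)) ^ 2 := by gcongr
    _ = ν Set.univ * ∫⁻ x, f x ^ 2 ∂ν := by
      rw [mul_pow, ← ENNReal.rpow_two, ← ENNReal.rpow_two, ← ENNReal.rpow_mul, ← ENNReal.rpow_mul]
      norm_num

theorem sq_enorm_sub_le_of_contDiff {F : Type*} [NormedAddCommGroup F] [NormedSpace ℝ F]
    {γ : ℝ → F} (hγ : ContDiff ℝ 1 γ) {s : Set ℝ} (hs : s.OrdConnected) {a b : ℝ}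
    (ha : a ∈ s) (hb : b ∈ s) :
    ‖γ a - γ b‖ₑ ^ 2 ≤ volume s * ∫⁻ t in s, ‖deriv γ t‖ₑ ^ 2 := by
  wlog hab : b ≤ a generalizing a b
  · rw [← enorm_neg, neg_sub]
    exact this hb ha (le_of_not_ge hab)
  have hc : Continuous (deriv γ) := hγ.continuous_deriv le_rfl
  calc ‖γ a - γ b‖ₑ ^ 2 ≤ (∫⁻ t in Set.Icc b a, ‖deriv γ t‖ₑ) ^ 2 := by
        gcongr
        refine (enorm_sub_le_lintegral_derivWithin_Icc_of_contDiffOn_Icc hγ.contDiffOn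
          hab).trans_eq ?_
        rw [Measure.restrict_congr_set Ioo_ae_eq_Icc.symm]
        refine setLIntegral_congr_fun measurableSet_Ioo fun t ht => ?_
        simp only [derivWithin_of_mem_nhds (Icc_mem_nhds ht.1 ht.2)]
    _ ≤ (∫⁻ t in s, ‖deriv γ t‖ₑ) ^ 2 := by
        gcongr
        exact hs.out hb ha
    _ ≤ volume s * ∫⁻ t in s, ‖deriv γ t‖ₑ ^ 2 := by
        simpa using ENNReal.sq_lintegral_le (volume.restrict s) hc.enorm.aemeasurable

theorem measure_mul_sq_enorm_sub_average_le {α F : Type*} [MeasurableSpace α]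
    [NormedAddCommGroup F] [NormedSpace ℝ F] [CompleteSpace F] (ν : Measure α)
    [IsFiniteMeasure ν] {u : α → F} (hu : Integrable u ν) (c : F) :
    ν Set.univ * ‖c - ⨍ y, u y ∂ν‖ₑ ^ 2 ≤ ∫⁻ y, ‖c - u y‖ₑ ^ 2 ∂ν := by
  rcases eq_or_ne ν 0 with rfl | hν
  · simp
  have : NeZero ν := ⟨hν⟩
  have hpos : ν Set.univ ≠ 0 := by simpa using hν
  have hfin : ν Set.univ ≠ ⊤ := measure_ne_top _ _
  have key : ν Set.univ * ‖c - ⨍ y, u y ∂ν‖ₑ ≤ ∫⁻ y, ‖c - u y‖ₑ ∂ν := by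
    have h1 : ν.real Set.univ • (c - ⨍ y, u y ∂ν) = ∫ y, (c - u y) ∂ν := by
      rw [smul_sub, measure_smul_average, integral_sub (integrable_const c) hu, integral_const]
    have h2 := enorm_integral_le_lintegral_enorm (μ := ν) fun y => c - u y
    rw [← h1, enorm_smul] at h2
    rwa [Real.enorm_of_nonneg measureReal_nonneg, ofReal_measureReal] at h2
  have h2 := (pow_le_pow_left' key 2).trans (ENNReal.sq_lintegral_le ν
    (aestronglyMeasurable_const.sub hu.aestronglyMeasurable).enorm)
  rw [mul_pow, sq (ν Set.univ), mul_assoc] at h2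
  exact (ENNReal.mul_le_mul_iff_right hpos hfin).1 h2

/-- The point of the Euclidean plane with polar coordinates `p = (r, θ)`. -/
noncomputable def polarPoint (p : ℝ × ℝ) : EuclideanSpace ℝ (Fin 2) :=
  !₂[p.1 * Real.cos p.2, p.1 * Real.sin p.2]

theorem contDiff_polarPoint {n : WithTop ℕ∞} : ContDiff ℝ n polarPoint := by
  rw [contDiff_euclidean]
  intro i
  fin_cases i
  · exact contDiff_fst.mul (Real.contDiff_cos.comp contDiff_snd)
  · exact contDiff_fst.mul (Real.contDiff_sin.comp contDiff_snd)

theorem norm_polarPoint (p : ℝ × ℝ) : ‖polarPoint p‖ = |p.1| := by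
  rw [EuclideanSpace.norm_eq, ← Real.sqrt_sq_eq_abs]
  congr 1
  simp only [polarPoint, Fin.sum_univ_two, Real.norm_eq_abs, sq_abs,
    PiLp.toLp_apply, Matrix.cons_val_zero,
    Matrix.cons_val_one]
  linear_combination p.1 ^ 2 * Real.sin_sq_add_cos_sq p.2

theorem measurePreserving_toLp_pair :
    MeasurePreserving fun q : ℝ × ℝ => (!₂[q.1, q.2] : EuclideanSpace ℝ (Fin 2)) :=
  (PiLp.volume_preserving_toLp (Fin 2)).comp (volume_preserving_finTwoArrow ℝ).symm

open scoped ENNReal in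
theorem setLIntegral_annulus_eq_polar {a b : ℝ} (ha : 0 < a) {f : EuclideanSpace ℝ (Fin 2) → ℝ≥0∞}
    (hf : Measurable f) :
    ∫⁻ x in Metric.ball 0 b \ Metric.ball 0 a, f x =
      ∫⁻ p, ENNReal.ofReal p.1 * f (polarPoint p)
        ∂((volume.restrict (Set.Ico a b)).prod (volume.restrict (Set.Ioo (-Real.pi) Real.pi))) := by
  have hA : MeasurableSet (Metric.ball (0 : EuclideanSpace ℝ (Fin 2)) b \ Metric.ball 0 a) :=
    measurableSet_ball.diff measurableSet_ball
  rw [← lintegral_indicator hA, ← measurePreserving_toLp_pair.lintegral_comp (hf.indicator hA),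
    ← lintegral_comp_polarCoord_symm, Measure.prod_restrict,
    ← lintegral_indicator polarCoord.open_target.measurableSet,
    ← lintegral_indicator (measurableSet_Ico.prod measurableSet_Ioo)]
  refine lintegral_congr fun p => ?_
  have hP : (!₂[(polarCoord.symm p).1, (polarCoord.symm p).2] : EuclideanSpace ℝ (Fin 2)) =
    polarPoint p := rfl
  by_cases hp : p ∈ polarCoord.target
  · have hp1 : 0 < p.1 := hp.1
    rw [Set.indicator_of_mem hp]
    have hmem : polarPoint p ∈ Metric.ball (0 : EuclideanSpace ℝ (Fin 2)) b \ Metric.ball 0 a ↔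
        p ∈ Set.Ico a b ×ˢ Set.Ioo (-Real.pi) Real.pi := by
      have h2 : p.2 ∈ Set.Ioo (-Real.pi) Real.pi := hp.2
      simp only [Set.mem_sdiff, mem_ball_zero_iff, norm_polarPoint, abs_of_pos hp1, not_lt,
        Set.mem_prod, Set.mem_Ico, h2, and_true]
      exact and_comm
    simp only [hP, smul_eq_mul]
    by_cases h : p ∈ Set.Ico a b ×ˢ Set.Ioo (-Real.pi) Real.pi
    · rw [Set.indicator_of_mem h, Set.indicator_of_mem (hmem.2 h)]
    · rw [Set.indicator_of_notMem h, Set.indicator_of_notMem (mt hmem.1 h), mul_zero]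
  · rw [Set.indicator_of_notMem hp, Set.indicator_of_notMem]
    exact fun h => hp ⟨ha.trans_le h.1.1, h.2⟩

section PolarBounds

variable {F : Type*} [NormedAddCommGroup F] [NormedSpace ℝ F] {u : EuclideanSpace ℝ (Fin 2) → F}

theorem enorm_deriv_polarPoint_radial_le (hu : ContDiff ℝ 1 u) (r θ : ℝ) :
    ‖deriv (fun r => u (polarPoint (r, θ))) r‖ₑ ≤ ‖fderiv ℝ u (polarPoint (r, θ))‖ₑ := by
  have h1 : HasDerivAt (fun r => polarPoint (r, θ)) (polarPoint (1, θ)) r := by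
    have : (fun r => polarPoint (r, θ)) = fun r : ℝ => r • polarPoint (1, θ) := by
      ext r i
      fin_cases i <;> simp [polarPoint]
    rw [this]
    simpa using (hasDerivAt_id r).smul_const (polarPoint (1, θ))
  have h2 := ((hu.differentiable one_ne_zero (polarPoint (r, θ))).hasFDerivAt).comp_hasDerivAt r h1
  rw [show deriv (fun r => u (polarPoint (r, θ))) r = _ from h2.deriv]
  refine (ContinuousLinearMap.le_opENorm _ _).trans_eq ?_
  rw [← ofReal_norm (polarPoint (1, θ)), norm_polarPoint]
  simp

theorem enorm_deriv_polarPoint_angular_le (hu : ContDiff ℝ 1 u) {r : ℝ} (hr : 0 ≤ r) (θ : ℝ) :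
    ‖deriv (fun θ => u (polarPoint (r, θ))) θ‖ₑ ≤
      ENNReal.ofReal r * ‖fderiv ℝ u (polarPoint (r, θ))‖ₑ := by
  have h1 : HasDerivAt (fun θ => polarPoint (r, θ)) (polarPoint (r, θ + Real.pi / 2)) θ := by
    have : (fun θ => polarPoint (r, θ)) = fun θ =>
        Real.cos θ • polarPoint (r, 0) + Real.sin θ • polarPoint (r, Real.pi / 2) := by
      ext θ i
      fin_cases i <;> simp [polarPoint, mul_comm]
    rw [this]
    refine (((Real.hasDerivAt_cos θ).smul_const (polarPoint (r, 0))).add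
      ((Real.hasDerivAt_sin θ).smul_const (polarPoint (r, Real.pi / 2)))).congr_deriv ?_
    ext i
    fin_cases i <;> simp [polarPoint, Real.cos_add_pi_div_two, Real.sin_add_pi_div_two, mul_comm]
  have h2 := ((hu.differentiable one_ne_zero (polarPoint (r, θ))).hasFDerivAt).comp_hasDerivAt θ h1
  rw [show deriv (fun θ => u (polarPoint (r, θ))) θ = _ from h2.deriv]
  refine (ContinuousLinearMap.le_opENorm _ _).trans_eq ?_
  rw [← ofReal_norm (polarPoint (r, θ + Real.pi / 2)), norm_polarPoint, abs_of_nonneg hr, mul_comm]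

theorem sq_enorm_sub_polarPoint_le (hu : ContDiff ℝ 1 u) {a b : ℝ} (ha : 0 < a)
    {p q : ℝ × ℝ} (hp1 : p.1 ∈ Set.Ico a b) (hq1 : q.1 ∈ Set.Ico a b)
    (hp2 : p.2 ∈ Set.Ioo (-Real.pi) Real.pi) (hq2 : q.2 ∈ Set.Ioo (-Real.pi) Real.pi) :
    ‖u (polarPoint p) - u (polarPoint q)‖ₑ ^ 2 ≤
      2 * (ENNReal.ofReal (b - a) *
          ∫⁻ r in Set.Ico a b, ‖fderiv ℝ u (polarPoint (r, p.2))‖ₑ ^ 2) +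
      2 * (ENNReal.ofReal (2 * Real.pi * b ^ 2) *
          ∫⁻ θ in Set.Ioo (-Real.pi) Real.pi, ‖fderiv ℝ u (polarPoint (q.1, θ))‖ₑ ^ 2) := by
  have hq0 : 0 ≤ q.1 := ha.le.trans hq1.1
  have hrad : ‖u (polarPoint p) - u (polarPoint (q.1, p.2))‖ₑ ^ 2 ≤ ENNReal.ofReal (b - a) *
      ∫⁻ r in Set.Ico a b, ‖fderiv ℝ u (polarPoint (r, p.2))‖ₑ ^ 2 := by
    have hc : ContDiff ℝ 1 fun r => u (polarPoint (r, p.2)) :=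
      hu.comp (contDiff_polarPoint.comp (contDiff_id.prodMk contDiff_const))
    refine (sq_enorm_sub_le_of_contDiff hc Set.ordConnected_Ico hp1 hq1).trans ?_
    rw [Real.volume_Ico]
    gcongr
    exact enorm_deriv_polarPoint_radial_le hu _ _
  have hang : ‖u (polarPoint (q.1, p.2)) - u (polarPoint q)‖ₑ ^ 2 ≤
      ENNReal.ofReal (2 * Real.pi * b ^ 2) *
        ∫⁻ θ in Set.Ioo (-Real.pi) Real.pi, ‖fderiv ℝ u (polarPoint (q.1, θ))‖ₑ ^ 2 := by
    have hc : ContDiff ℝ 1 fun θ => u (polarPoint (q.1, θ)) :=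
      hu.comp (contDiff_polarPoint.comp (contDiff_const.prodMk contDiff_id))
    refine (sq_enorm_sub_le_of_contDiff hc Set.ordConnected_Ioo hp2 hq2).trans ?_
    rw [Real.volume_Ioo, sub_neg_eq_add, ← two_mul,
      ENNReal.ofReal_mul (p := 2 * Real.pi) (by positivity), mul_assoc]
    refine mul_le_mul' (le_refl (ENNReal.ofReal (2 * Real.pi))) ?_
    rw [← lintegral_const_mul' _ _ ENNReal.ofReal_ne_top]
    refine lintegral_mono fun θ => ?_
    refine (ENNReal.pow_le_pow_left (enorm_deriv_polarPoint_angular_le hu hq0 θ)).trans ?_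
    rw [mul_pow, ← ENNReal.ofReal_pow hq0]
    gcongr
    exact hq1.2.le
  calc ‖u (polarPoint p) - u (polarPoint q)‖ₑ ^ 2
      ≤ (‖u (polarPoint p) - u (polarPoint (q.1, p.2))‖ₑ +
          ‖u (polarPoint (q.1, p.2)) - u (polarPoint q)‖ₑ) ^ 2 := by
        gcongr
        rw [← sub_add_sub_cancel _ (u (polarPoint (q.1, p.2))) _]
        exact enorm_add_le _ _
    _ ≤ 2 * ‖u (polarPoint p) - u (polarPoint (q.1, p.2))‖ₑ ^ 2 +
          2 * ‖u (polarPoint (q.1, p.2)) - u (polarPoint q)‖ₑ ^ 2 := by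
        rw [← mul_add]
        simpa [ENNReal.rpow_two, show (2 : ℝ) - 1 = 1 by norm_num] using
          ENNReal.rpow_add_le_mul_rpow_add_rpow ‖u (polarPoint p) - u (polarPoint (q.1, p.2))‖ₑ
            ‖u (polarPoint (q.1, p.2)) - u (polarPoint q)‖ₑ one_le_two
    _ ≤ _ := by gcongr

end PolarBounds

theorem lintegral_lintegral_sq_enorm_sub_polarPoint_le {F : Type*} [NormedAddCommGroup F]
    [NormedSpace ℝ F] {u : EuclideanSpace ℝ (Fin 2) → F} (hu : ContDiff ℝ 1 u) {a b : ℝ}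
    (ha : 0 < a) (hab : a ≤ b) {ν : Measure (ℝ × ℝ)}
    (hν : ν = (volume.restrict (Set.Ico a b)).prod
      (volume.restrict (Set.Ioo (-Real.pi) Real.pi))) :
    ∫⁻ p, ∫⁻ q, ‖u (polarPoint p) - u (polarPoint q)‖ₑ ^ 2 ∂ν ∂ν ≤
      ENNReal.ofReal (4 * Real.pi * (b - a) * ((b - a) ^ 2 + 4 * Real.pi ^ 2 * b ^ 2)) *
        ∫⁻ p, ‖fderiv ℝ u (polarPoint p)‖ₑ ^ 2 ∂ν := by
  have hG : Measurable fun p => ‖fderiv ℝ u (polarPoint p)‖ₑ ^ 2 :=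
    (((hu.continuous_fderiv one_ne_zero).comp
      (contDiff_polarPoint (n := 1)).continuous).enorm.measurable.pow_const 2)
  have hpi : 0 ≤ Real.pi := Real.pi_pos.le
  have hba : 0 ≤ b - a := sub_nonneg.2 hab
  set G : ℝ × ℝ → ENNReal := fun p => ‖fderiv ℝ u (polarPoint p)‖ₑ ^ 2
  set I : Measure ℝ := volume.restrict (Set.Ico a b) with hI
  set T : Measure ℝ := volume.restrict (Set.Ioo (-Real.pi) Real.pi) with hT
  have hIu : I Set.univ = ENNReal.ofReal (b - a) := by simp [hI]
  have hTu : T Set.univ = ENNReal.ofReal (2 * Real.pi) := by simp [hT, two_mul]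
  have hνu : ν Set.univ = ENNReal.ofReal (b - a) * ENNReal.ofReal (2 * Real.pi) := by
    rw [hν, ← Set.univ_prod_univ, Measure.prod_prod, hIu, hTu]
  have hmem : ∀ᵐ p ∂ν, p.1 ∈ Set.Ico a b ∧ p.2 ∈ Set.Ioo (-Real.pi) Real.pi := by
    rw [hν, hI, hT, Measure.prod_restrict]
    exact ae_restrict_mem (measurableSet_Ico.prod measurableSet_Ioo)
  have hm1 : Measurable fun θ => ∫⁻ r, G (r, θ) ∂I := hG.lintegral_prod_left'
  have hm2 : Measurable fun r => ∫⁻ θ, G (r, θ) ∂T := hG.lintegral_prod_right'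
  have hrad : ∫⁻ p, ∫⁻ r, G (r, p.2) ∂I ∂ν = ENNReal.ofReal (b - a) * ∫⁻ p, G p ∂ν := by
    rw [hν, lintegral_prod_symm' (fun p : ℝ × ℝ => ∫⁻ r, G (r, p.2) ∂I)
      (hm1.comp measurable_snd), lintegral_prod_symm' _ hG]
    simp only [lintegral_const, hIu]
    rw [lintegral_mul_const _ hm1, mul_comm]
  have hang : ∫⁻ q, ∫⁻ θ, G (q.1, θ) ∂T ∂ν =
      ENNReal.ofReal (2 * Real.pi) * ∫⁻ p, G p ∂ν := by
    rw [hν, lintegral_prod (fun q : ℝ × ℝ => ∫⁻ θ, G (q.1, θ) ∂T)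
        (hm2.comp measurable_fst).aemeasurable,
      lintegral_prod _ hG.aemeasurable]
    simp only [lintegral_const, hTu]
    rw [lintegral_mul_const _ hm2, mul_comm]
  calc ∫⁻ p, ∫⁻ q, ‖u (polarPoint p) - u (polarPoint q)‖ₑ ^ 2 ∂ν ∂ν
      ≤ ∫⁻ p, ∫⁻ q, (2 * (ENNReal.ofReal (b - a) * ∫⁻ r, G (r, p.2) ∂I) +
          2 * (ENNReal.ofReal (2 * Real.pi * b ^ 2) * ∫⁻ θ, G (q.1, θ) ∂T)) ∂ν ∂ν := by
        refine lintegral_mono_ae ?_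
        filter_upwards [hmem] with p hp
        refine lintegral_mono_ae ?_
        filter_upwards [hmem] with q hq
        exact sq_enorm_sub_polarPoint_le hu ha hp.1 hq.1 hp.2 hq.2
    _ = ν Set.univ * (2 * (ENNReal.ofReal (b - a) * (ENNReal.ofReal (b - a) * ∫⁻ p, G p ∂ν)) +
          2 * (ENNReal.ofReal (2 * Real.pi * b ^ 2) *
            (ENNReal.ofReal (2 * Real.pi) * ∫⁻ p, G p ∂ν))) := by
        have hm1' : Measurable fun p : ℝ × ℝ => ∫⁻ r, G (r, p.2) ∂I := hm1.comp measurable_snd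
        have hm2' : Measurable fun q : ℝ × ℝ => ∫⁻ θ, G (q.1, θ) ∂T := hm2.comp measurable_fst
        simp_rw [lintegral_add_left measurable_const, lintegral_const]
        rw [lintegral_add_right _ measurable_const, lintegral_const,
          lintegral_mul_const _ ((hm1'.const_mul _).const_mul _),
          lintegral_const_mul _ (hm1'.const_mul _), lintegral_const_mul _ hm1',
          lintegral_const_mul _ (hm2'.const_mul _), lintegral_const_mul _ hm2', hrad, hang]
        ring
    _ = _ := by
        rw [hνu, show (2 : ENNReal) = ENNReal.ofReal 2 by simp]
        simp only [← mul_assoc]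
        rw [← add_mul, ← mul_assoc]
        congr 1
        rw [← ENNReal.ofReal_mul (by positivity), ← ENNReal.ofReal_mul (by positivity),
          ← ENNReal.ofReal_mul (by positivity), ← ENNReal.ofReal_mul (by positivity),
          ← ENNReal.ofReal_mul (by positivity), ← ENNReal.ofReal_add (by positivity)
            (by positivity), ← ENNReal.ofReal_mul (by positivity)]
        congr 1
        ring

/-- Poincaré inequality with mean value on a planar annulus. -/
theorem setLIntegral_annulus_sq_enorm_sub_average_le {F : Type*} [NormedAddCommGroup F]
    [NormedSpace ℝ F] [CompleteSpace F] {u : EuclideanSpace ℝ (Fin 2) → F}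
    (hu : ContDiff ℝ 1 u) {N : ℝ} (hN : 0 < N)
    {A : Set (EuclideanSpace ℝ (Fin 2))} (hA : A = Metric.ball 0 N \ Metric.ball 0 (N / 2)) :
    ∫⁻ x in A, ‖u x - ⨍ z in A, u z‖ₑ ^ 2 ≤
      ENNReal.ofReal ((4 + 64 * Real.pi ^ 2) * N ^ 2) * ∫⁻ x in A, ‖fderiv ℝ u x‖ₑ ^ 2 := by
  have hpi : 0 < Real.pi := Real.pi_pos
  have hN2 : 0 < N / 2 := half_pos hN
  set ν : Measure (ℝ × ℝ) := (volume.restrict (Set.Ico (N / 2) N)).prod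
    (volume.restrict (Set.Ioo (-Real.pi) Real.pi)) with hν
  have hmem : ∀ᵐ p ∂ν, p.1 ∈ Set.Ico (N / 2) N := by
    rw [hν, Measure.prod_restrict]
    filter_upwards [ae_restrict_mem (measurableSet_Ico.prod measurableSet_Ioo)] with p hp
    exact hp.1
  have hPm : Measurable polarPoint := (contDiff_polarPoint (n := 1)).continuous.measurable
  have hupper : ∀ f : EuclideanSpace ℝ (Fin 2) → ENNReal, Measurable f →
      ∫⁻ x in A, f x ≤ ENNReal.ofReal N * ∫⁻ p, f (polarPoint p) ∂ν := by
    intro f hf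
    rw [hA, setLIntegral_annulus_eq_polar hN2 hf, ← lintegral_const_mul' _ _ ENNReal.ofReal_ne_top]
    refine lintegral_mono_ae ?_
    filter_upwards [hmem] with p hp
    gcongr
    exact hp.2.le
  have hlower : ∀ f : EuclideanSpace ℝ (Fin 2) → ENNReal, Measurable f →
      ENNReal.ofReal (N / 2) * ∫⁻ p, f (polarPoint p) ∂ν ≤ ∫⁻ x in A, f x := by
    intro f hf
    rw [hA, setLIntegral_annulus_eq_polar hN2 hf, ← lintegral_const_mul' _ _ ENNReal.ofReal_ne_top]
    refine lintegral_mono_ae ?_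
    filter_upwards [hmem] with p hp
    gcongr
    exact hp.1
  have hAball : A ⊆ Metric.closedBall 0 N := by
    rw [hA]
    exact Set.sdiff_subset.trans Metric.ball_subset_closedBall
  have hfin : IsFiniteMeasure (volume.restrict A) :=
    isFiniteMeasure_restrict.2 (measure_ne_top_of_subset hAball measure_closedBall_lt_top.ne)
  have hint : Integrable u (volume.restrict A) :=
    (hu.continuous.continuousOn.integrableOn_compact (isCompact_closedBall 0 N)).mono_set hAball
  have hvol : ENNReal.ofReal (N ^ 2 * Real.pi / 2) ≤ volume A := by
    have h := hlower (fun _ => 1) measurable_const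
    rw [lintegral_one, setLIntegral_one, hν, ← Set.univ_prod_univ, Measure.prod_prod] at h
    refine le_trans (le_of_eq ?_) h
    rw [Measure.restrict_apply_univ, Measure.restrict_apply_univ, Real.volume_Ico,
      Real.volume_Ioo, ← ENNReal.ofReal_mul (by linarith), ← ENNReal.ofReal_mul hN2.le]
    congr 1
    ring
  have hsub : Measurable fun z : EuclideanSpace ℝ (Fin 2) × EuclideanSpace ℝ (Fin 2) =>
      ‖u z.1 - u z.2‖ₑ ^ 2 := by
    have := hu.continuous
    exact Continuous.measurable (by fun_prop)
  have hgrad : Measurable fun x => ‖fderiv ℝ u x‖ₑ ^ 2 :=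
    ((hu.continuous_fderiv one_ne_zero).enorm.measurable.pow_const 2)
  have hdouble : ∫⁻ x in A, ∫⁻ y in A, ‖u x - u y‖ₑ ^ 2 ≤
      ENNReal.ofReal ((2 + 32 * Real.pi ^ 2) * Real.pi * N ^ 4) *
        ∫⁻ x in A, ‖fderiv ℝ u x‖ₑ ^ 2 := by
    calc ∫⁻ x in A, ∫⁻ y in A, ‖u x - u y‖ₑ ^ 2
        ≤ ∫⁻ x in A, ENNReal.ofReal N * ∫⁻ q, ‖u x - u (polarPoint q)‖ₑ ^ 2 ∂ν :=
          lintegral_mono fun x => hupper _ (hsub.comp measurable_prodMk_left)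
      _ ≤ ENNReal.ofReal N * ∫⁻ p, ENNReal.ofReal N *
            ∫⁻ q, ‖u (polarPoint p) - u (polarPoint q)‖ₑ ^ 2 ∂ν ∂ν :=
          hupper (fun x => ENNReal.ofReal N * ∫⁻ q, ‖u x - u (polarPoint q)‖ₑ ^ 2 ∂ν)
            ((Measurable.lintegral_prod_right' (f := fun z :
              EuclideanSpace ℝ (Fin 2) × (ℝ × ℝ) => ‖u z.1 - u (polarPoint z.2)‖ₑ ^ 2)
              (hsub.comp (measurable_fst.prodMk (hPm.comp measurable_snd)))).const_mul _)
      _ ≤ ENNReal.ofReal N * (ENNReal.ofReal N * (ENNReal.ofReal (4 * Real.pi * (N - N / 2) *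
            ((N - N / 2) ^ 2 + 4 * Real.pi ^ 2 * N ^ 2)) *
              ∫⁻ p, ‖fderiv ℝ u (polarPoint p)‖ₑ ^ 2 ∂ν)) := by
          rw [lintegral_const_mul' _ _ ENNReal.ofReal_ne_top]
          gcongr
          exact lintegral_lintegral_sq_enorm_sub_polarPoint_le hu hN2 (by linarith) hν
      _ = ENNReal.ofReal ((1 + 16 * Real.pi ^ 2) * Real.pi * N ^ 4) *
            (ENNReal.ofReal (N / 2) * ∫⁻ p, ‖fderiv ℝ u (polarPoint p)‖ₑ ^ 2 ∂ν) := by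
          have : 0 ≤ N - N / 2 := by linarith
          simp only [← mul_assoc]
          rw [← ENNReal.ofReal_mul (by positivity), ← ENNReal.ofReal_mul (by positivity),
            ← ENNReal.ofReal_mul (by positivity)]
          congr 2
          ring
      _ ≤ _ := by
          gcongr
          · linarith
          · linarith
          · exact hlower _ hgrad
  have hmain : ENNReal.ofReal (N ^ 2 * Real.pi / 2) * ∫⁻ x in A, ‖u x - ⨍ z in A, u z‖ₑ ^ 2 ≤
      ENNReal.ofReal (N ^ 2 * Real.pi / 2) *
        (ENNReal.ofReal ((4 + 64 * Real.pi ^ 2) * N ^ 2) * ∫⁻ x in A, ‖fderiv ℝ u x‖ₑ ^ 2) := by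
    calc ENNReal.ofReal (N ^ 2 * Real.pi / 2) * ∫⁻ x in A, ‖u x - ⨍ z in A, u z‖ₑ ^ 2
        ≤ volume A * ∫⁻ x in A, ‖u x - ⨍ z in A, u z‖ₑ ^ 2 := by gcongr
      _ = ∫⁻ x in A, volume A * ‖u x - ⨍ z in A, u z‖ₑ ^ 2 := by
          have := hu.continuous
          rw [lintegral_const_mul _ (Continuous.measurable (by fun_prop))]
      _ ≤ ∫⁻ x in A, ∫⁻ y in A, ‖u x - u y‖ₑ ^ 2 := by
          refine lintegral_mono fun x => ?_
          simpa using measure_mul_sq_enorm_sub_average_le (volume.restrict A) hint (u x)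
      _ ≤ _ := hdouble
      _ = _ := by
          rw [← mul_assoc, ← ENNReal.ofReal_mul (by positivity)]
          congr 2
          ring
  exact (ENNReal.mul_le_mul_iff_right (ENNReal.ofReal_pos.2 (by positivity)).ne'
    ENNReal.ofReal_ne_top).1 hmain

theorem eLpNorm_annulus_sub_average_le {F : Type*} [NormedAddCommGroup F]
    [NormedSpace ℝ F] [CompleteSpace F] {u : EuclideanSpace ℝ (Fin 2) → F}
    (hu : ContDiff ℝ 1 u) {N : ℝ} (hN : 0 < N)
    {A : Set (EuclideanSpace ℝ (Fin 2))} (hA : A = Metric.ball 0 N \ Metric.ball 0 (N / 2)) :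
    eLpNorm (fun x => u x - ⨍ z in A, u z) 2 (volume.restrict A) ≤
      ENNReal.ofReal (33 * N) * eLpNorm (fderiv ℝ u) 2 (volume.restrict A) := by
  have hsq : ∀ {G : Type _} [NormedAddCommGroup G] (f : EuclideanSpace ℝ (Fin 2) → G),
      eLpNorm f 2 (volume.restrict A) ^ 2 = ∫⁻ x in A, ‖f x‖ₑ ^ 2 := by
    intro G _ f
    simpa using eLpNorm_nnreal_pow_eq_lintegral (f := f) (μ := volume.restrict A)
      (p := 2) two_ne_zero
  refine (ENNReal.pow_le_pow_left_iff two_ne_zero).1 ?_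
  rw [mul_pow, hsq, hsq, ← ENNReal.ofReal_pow (by positivity)]
  refine (setLIntegral_annulus_sq_enorm_sub_average_le hu hN hA).trans ?_
  gcongr
  rw [mul_pow]
  gcongr
  nlinarith [Real.pi_le_four, Real.pi_pos]

theorem deriv_eq_zero_of_eq_zero_on_Ici {μ : ℝ → ℝ} (hμ : Differentiable ℝ μ) {c : ℝ}
    (h : ∀ t, c ≤ t → μ t = 0) {t : ℝ} (ht : c ≤ t) : deriv μ t = 0 := by
  rw [← (hμ t).derivWithin (uniqueDiffOn_Ici c t ht),
    derivWithin_congr (f := fun _ => (0 : ℝ)) (s := Set.Ici c) (fun s hs => h s hs) (h t ht)]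
  simp

theorem exists_bound_of_eq_zero_on_Ici {f : ℝ → ℝ} (hf : Continuous f) {c : ℝ}
    (h : ∀ t, c ≤ t → f t = 0) : ∃ K : ℝ, 0 ≤ K ∧ ∀ t, 0 ≤ t → |f t| ≤ K := by
  obtain ⟨K, hK⟩ := (isCompact_Icc (a := 0) (b := c)).exists_bound_of_continuousOn hf.continuousOn
  refine ⟨max K 0, le_max_right _ _, fun t ht => ?_⟩
  rcases le_total t c with htc | htc
  · exact (hK t ⟨ht, htc⟩).trans (le_max_left _ _)
  · simp [h t htc]

section Cutoff

variable {E F : Type*} [NormedAddCommGroup E] [InnerProductSpace ℝ E]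
  [NormedAddCommGroup F] [NormedSpace ℝ F] {μ : ℝ → ℝ} {u : E → F} {N : ℝ}

theorem fderiv_cutoff_sub_eq_zero (hμ1 : ∀ t : ℝ, 0 ≤ t → t ≤ 1 / 2 → μ t = 1) (hN : 0 < N)
    (a : F) {x : E} (hx : ‖x‖ < N / 2) :
    fderiv ℝ (fun y => μ (‖y‖ / N) • (u y - a)) x - fderiv ℝ u x = 0 := by
  have h : (fun y => μ (‖y‖ / N) • (u y - a)) =ᶠ[nhds x] fun y => u y - a := by
    filter_upwards [(isOpen_lt continuous_norm continuous_const).mem_nhds hx] with y hy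
    have hy' : ‖y‖ < N / 2 := hy
    rw [hμ1 _ (by positivity) (by rw [div_le_iff₀ hN]; linarith), one_smul]
  rw [h.fderiv_eq, fderiv_sub_const, sub_self]

theorem norm_fderiv_cutoff_sub_le (hμ : Differentiable ℝ μ) (hu : Differentiable ℝ u)
    (hN : 0 < N) (a : F) {x : E} (hx : x ≠ 0) :
    ‖fderiv ℝ (fun y => μ (‖y‖ / N) • (u y - a)) x - fderiv ℝ u x‖ ≤
      (|μ (‖x‖ / N)| + 1) * ‖fderiv ℝ u x‖ + |deriv μ (‖x‖ / N)| / N * ‖u x - a‖ := by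
  have hn : HasFDerivAt (fun y : E => ‖y‖) (fderiv ℝ (fun y : E => ‖y‖) x) x :=
    ((contDiffAt_norm ℝ hx (n := 1)).differentiableAt one_ne_zero).hasFDerivAt
  have hc := (hμ (‖x‖ / N)).hasDerivAt.comp_hasFDerivAt x (hn.mul_const N⁻¹)
  have h : HasFDerivAt (fun y => μ (‖y‖ / N) • (u y - a)) _ x :=
    HasFDerivAt.smul (c := fun y => μ (‖y‖ / N)) hc ((hu x).hasFDerivAt.sub_const a)
  rw [h.fderiv]
  have h1 : ‖fderiv ℝ (fun y : E => ‖y‖) x‖ ≤ 1 := by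
    simpa using norm_fderiv_le_of_lipschitz ℝ (lipschitzWith_one_norm (E := E)) (x₀ := x)
  have h2 : ‖(deriv μ (‖x‖ / N) • N⁻¹ • fderiv ℝ (fun y : E => ‖y‖) x).smulRight (u x - a)‖ ≤
      |deriv μ (‖x‖ / N)| / N * ‖u x - a‖ := by
    rw [ContinuousLinearMap.norm_smulRight_apply, norm_smul, norm_smul, Real.norm_eq_abs,
      Real.norm_eq_abs, abs_of_pos (inv_pos.2 hN), div_eq_mul_inv |deriv μ (‖x‖ / N)| N]
    gcongr
    exact mul_le_of_le_one_right (inv_pos.2 hN).le h1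
  calc _ ≤ ‖μ (‖x‖ / N) • fderiv ℝ u x‖ +
        ‖(deriv μ (‖x‖ / N) • N⁻¹ • fderiv ℝ (fun y : E => ‖y‖) x).smulRight (u x - a)‖ +
          ‖fderiv ℝ u x‖ := by
        refine (norm_sub_le _ _).trans ?_
        gcongr
        exact norm_add_le _ _
    _ ≤ _ := by
      rw [norm_smul, Real.norm_eq_abs]
      linarith

end Cutoff

/-- **Far-field truncation (cut-off) estimate** (Lemma 6.2(b) of the paper): for a fixed
`C¹` cut-off `μ` with `μ = 1` on `[0,1/2]` and `μ = 0` on `[1,∞)`, there is `C = C(μ)` such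
that for every `N > 0`, every `C¹` displacement `u : ℝ² → ℝᵐ` and every measurable
`S ⊇ B_N`, the truncation `Lu(x) = μ(|x|/N)(u(x) − a)`, with `a` the average of `u` over
the annulus `B_N ∖ B_{N/2}`, satisfies `‖∇(Lu) − ∇u‖_{L²(S)} ≤ C ‖∇u‖_{L²(S ∖ B_{N/2})}`. -/
theorem cutoff_gradient_estimate (μ : ℝ → ℝ) (hμ : ContDiff ℝ 1 μ)
    (hμ1 : ∀ t : ℝ, 0 ≤ t → t ≤ 1 / 2 → μ t = 1)
    (hμ0 : ∀ t : ℝ, 1 ≤ t → μ t = 0) :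
    ∃ C : ℝ, 0 < C ∧
    ∀ (m : ℕ) (N : ℝ), 0 < N →
    ∀ u : EuclideanSpace ℝ (Fin 2) → EuclideanSpace ℝ (Fin m), ContDiff ℝ 1 u →
    ∀ S : Set (EuclideanSpace ℝ (Fin 2)), MeasurableSet S → Metric.ball 0 N ⊆ S →
      eLpNorm (fun x =>
          fderiv ℝ (fun y => μ (‖y‖ / N) •
            (u y - ⨍ z in Metric.ball (0 : EuclideanSpace ℝ (Fin 2)) N \
                Metric.ball (0 : EuclideanSpace ℝ (Fin 2)) (N / 2), u z)) x
          - fderiv ℝ u x) 2 (volume.restrict S)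
        ≤ ENNReal.ofReal C *
            eLpNorm (fderiv ℝ u) 2
              (volume.restrict (S \ Metric.ball 0 (N / 2))) := by
  have hμd : Differentiable ℝ μ := hμ.differentiable one_ne_zero
  have hμ'0 : ∀ t : ℝ, 1 ≤ t → deriv μ t = 0 := fun t ht =>
    deriv_eq_zero_of_eq_zero_on_Ici hμd hμ0 ht
  obtain ⟨K, hK0, hK⟩ := exists_bound_of_eq_zero_on_Ici hμ.continuous hμ0
  obtain ⟨K', hK'0, hK'⟩ := exists_bound_of_eq_zero_on_Ici (hμ.continuous_deriv le_rfl) hμ'0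
  refine ⟨K + 1 + K' * 33, by positivity, fun m N hN u hu S hS hNS => ?_⟩
  set A := Metric.ball (0 : EuclideanSpace ℝ (Fin 2)) N \
    Metric.ball (0 : EuclideanSpace ℝ (Fin 2)) (N / 2) with hA
  set a := ⨍ z in A, u z
  set B := (Metric.ball (0 : EuclideanSpace ℝ (Fin 2)) (N / 2))ᶜ with hB
  have hSB : S \ Metric.ball 0 (N / 2) = B ∩ S := by
    rw [Set.sdiff_eq, Set.inter_comm]
  have hAm : MeasurableSet A := measurableSet_ball.diff measurableSet_ball
  have hBm : MeasurableSet B := measurableSet_ball.compl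
  have hAS : A ∩ S = A := Set.inter_eq_left.2 (Set.sdiff_subset.trans hNS)
  have hAB : A ⊆ B ∩ S := fun x hx => ⟨hx.2, hNS hx.1⟩
  have hdc : Continuous (fderiv ℝ u) := hu.continuous_fderiv one_ne_zero
  have huc : Continuous fun x => u x - a := hu.continuous.sub continuous_const
  set g₁ : EuclideanSpace ℝ (Fin 2) → ℝ := (K + 1) • fun x => ‖fderiv ℝ u x‖ with hg₁
  set g₂ : EuclideanSpace ℝ (Fin 2) → ℝ := (K' / N) • fun x => ‖u x - a‖ with hg₂
  have hg₁m : StronglyMeasurable g₁ := (hdc.norm.const_smul (K + 1)).stronglyMeasurable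
  have hg₂m : StronglyMeasurable g₂ := (huc.norm.const_smul (K' / N)).stronglyMeasurable
  have hpt : ∀ x, ‖fderiv ℝ (fun y => μ (‖y‖ / N) • (u y - a)) x - fderiv ℝ u x‖ ≤
      (B.indicator g₁ + A.indicator g₂) x := by
    intro x
    rcases lt_or_ge ‖x‖ (N / 2) with hx | hx
    · rw [fderiv_cutoff_sub_eq_zero hμ1 hN a hx, norm_zero]
      exact add_nonneg
        (Set.indicator_nonneg (fun y _ => by simp only [hg₁, Pi.smul_apply]; positivity) x)
        (Set.indicator_nonneg (fun y _ => by simp only [hg₂, Pi.smul_apply]; positivity) x)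
    have hx0 : x ≠ 0 := norm_pos_iff.1 ((half_pos hN).trans_le hx)
    have hxB : x ∈ B := by simpa [hB] using hx
    refine (norm_fderiv_cutoff_sub_le hμd (hu.differentiable one_ne_zero) hN a hx0).trans ?_
    rw [Pi.add_apply, Set.indicator_of_mem hxB]
    refine add_le_add (mul_le_mul_of_nonneg_right (by linarith [hK (‖x‖ / N) (by positivity)])
      (norm_nonneg _)) ?_
    by_cases hxA : x ∈ A
    · rw [Set.indicator_of_mem hxA]
      simp only [hg₂, Pi.smul_apply, smul_eq_mul]
      gcongr
      exact hK' _ (by positivity)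
    · have hxN : N ≤ ‖x‖ := by
        by_contra! h
        exact hxA ⟨by simpa using h, hxB⟩
      rw [Set.indicator_of_notMem hxA, hμ'0 _ ((one_le_div hN).2 hxN)]
      simp
  have h₁ : eLpNorm (B.indicator g₁) 2 (volume.restrict S) =
      ENNReal.ofReal (K + 1) * eLpNorm (fderiv ℝ u) 2 (volume.restrict (B ∩ S)) := by
    rw [eLpNorm_indicator_eq_eLpNorm_restrict hBm, Measure.restrict_restrict hBm, hg₁,
      eLpNorm_const_smul, eLpNorm_norm, Real.enorm_of_nonneg (by positivity)]
  have h₂ : eLpNorm (A.indicator g₂) 2 (volume.restrict S) ≤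
      ENNReal.ofReal (K' * 33) * eLpNorm (fderiv ℝ u) 2 (volume.restrict (B ∩ S)) := by
    rw [eLpNorm_indicator_eq_eLpNorm_restrict hAm, Measure.restrict_restrict hAm, hAS, hg₂,
      eLpNorm_const_smul, eLpNorm_norm, Real.enorm_of_nonneg (by positivity)]
    calc _ ≤ ENNReal.ofReal (K' / N) * (ENNReal.ofReal (33 * N) *
          eLpNorm (fderiv ℝ u) 2 (volume.restrict A)) := by
          gcongr
          exact eLpNorm_annulus_sub_average_le hu hN hA
      _ = ENNReal.ofReal (K' * 33) * eLpNorm (fderiv ℝ u) 2 (volume.restrict A) := by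
          rw [← mul_assoc, ← ENNReal.ofReal_mul (by positivity)]
          congr 2
          field_simp
      _ ≤ _ := by
          gcongr
  rw [hSB, ENNReal.ofReal_add (by positivity) (by positivity), add_mul]
  calc _ ≤ eLpNorm (B.indicator g₁ + A.indicator g₂) 2 (volume.restrict S) :=
        eLpNorm_mono_real hpt
    _ ≤ eLpNorm (B.indicator g₁) 2 (volume.restrict S) +
          eLpNorm (A.indicator g₂) 2 (volume.restrict S) :=
        eLpNorm_add_le (hg₁m.indicator hBm).aestronglyMeasurable
          (hg₂m.indicator hAm).aestronglyMeasurable one_le_two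
    _ ≤ _ := add_le_add h₁.le h₂
end
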